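/- arXiv:1708.02641 — 2 statements merged into one kernel-verified Lean document; each statement's English description precedes it below -/
import Mathlib

section
/- Let C and B be weakly dual Hopf algebras over a field k with pairing ev, let σ be a right 2-cocycle on B and τ a left 2-cocycle on C. Define σ∘τ: Drin_k(C,B)⊗Drin_k(C,B)→k by (σ∘τ)((b⊗c)⊗(b'⊗c')) := σ(b⊗b'₍₂₎) τ(c₍₁₎⊗c') ev(c₍₂₎, b'₍₁₎). Then σ∘τ is a right 2-cocycle on the bialgebra Drin_k(C,B): it is convolution invertible, satisfies (σ∘τ)(x ⊗ y₍₁₎z₍₁₎)(σ∘τ)(y₍₂₎ ⊗ z₍₂₎) = (σ∘τ)(x₍₁₎y₍₁₎ ⊗ z)(σ∘τ)(x₍₂₎ ⊗ y₍₂₎) for all x,y,z ∈ Drin_k(C,B) (Sweedler components taken with the coproduct of Drin_k(C,B), products taken in Drin_k(C,B)), and (σ∘τ)(x⊗1) = (σ∘τ)(1⊗x) = ε(x). -/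
/-!
STATEMENT 14: For weakly dual Hopf algebras `C`, `B` with pairing `ev`, a right 2-cocycle
`σ` on `B` and a left 2-cocycle `τ` on `C`, the map
`(σ∘τ)((b⊗c)⊗(b'⊗c')) = σ(b⊗b'₍₂₎) τ(c₍₁₎⊗c') ev(c₍₂₎, b'₍₁₎)`
is a right 2-cocycle on the Drinfeld double `Drin_k(C,B)`.

The Drinfeld double is realized on the vector space `B ⊗ C`, with its coproduct
`DrinComul` and counit `DrinCounit` defined below, and its product characterized by the
predicate `IsDrinMul`.
-/

open scoped TensorProduct

noncomputable section

variable {k B C : Type} [Field k] [Ring B] [HopfAlgebra k B] [Ring C] [HopfAlgebra k C]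

/-- `ev : C × B → k` is a weak Hopf algebra pairing. -/
def IsWeakHopfPairing (ev : C →ₗ[k] B →ₗ[k] k) : Prop :=
  (∀ (c c' : C) (b : B) (n : ℕ) (b1 b2 : Fin n → B),
    Coalgebra.comul (R := k) b = ∑ i, b1 i ⊗ₜ[k] b2 i →
    ev (c * c') b = ∑ i, ev c (b2 i) * ev c' (b1 i)) ∧
  (∀ (c : C) (b b' : B) (m : ℕ) (c1 c2 : Fin m → C),
    Coalgebra.comul (R := k) c = ∑ j, c1 j ⊗ₜ[k] c2 j →
    ev c (b * b') = ∑ j, ev (c1 j) b' * ev (c2 j) b) ∧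
  (∀ b : B, ev 1 b = Coalgebra.counit (R := k) b) ∧
  (∀ c : C, ev c 1 = Coalgebra.counit (R := k) c) ∧
  (∀ (c : C) (b : B),
    ev (HopfAlgebra.antipode (R := k) c) b = ev c (HopfAlgebra.antipode (R := k) b))

/-- The coproduct of the Drinfeld double: `Δ(b⊗c) = (b₍₁₎⊗c₍₂₎) ⊗ (b₍₂₎⊗c₍₁₎)`. -/
def DrinComul (k B C : Type) [Field k] [Ring B] [HopfAlgebra k B] [Ring C]
    [HopfAlgebra k C] : B ⊗[k] C →ₗ[k] (B ⊗[k] C) ⊗[k] (B ⊗[k] C) :=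
  (TensorProduct.tensorTensorTensorComm k B B C C).toLinearMap
    ∘ₗ TensorProduct.map (Coalgebra.comul (R := k))
        ((TensorProduct.comm k C C).toLinearMap ∘ₗ Coalgebra.comul (R := k))

/-- The counit of the Drinfeld double: `ε(b⊗c) = ε(b)ε(c)`. -/
def DrinCounit (k B C : Type) [Field k] [Ring B] [HopfAlgebra k B] [Ring C]
    [HopfAlgebra k C] : B ⊗[k] C →ₗ[k] k :=
  LinearMap.mul' k k ∘ₗ TensorProduct.map (Coalgebra.counit (R := k)) (Coalgebra.counit (R := k))

/-- `mD` is the product of the Drinfeld double `Drin_k(C,B)`: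
`(b⊗c)(b'⊗c') = b b'₍₂₎ ⊗ c₍₂₎c' · ev(c₍₁₎, S(b'₍₃₎)) · ev(c₍₃₎, b'₍₁₎)`. -/
def IsDrinMul (ev : C →ₗ[k] B →ₗ[k] k)
    (mD : (B ⊗[k] C) ⊗[k] (B ⊗[k] C) →ₗ[k] B ⊗[k] C) : Prop :=
  ∀ (b : B) (c : C) (b' : B) (c' : C)
    (n : ℕ) (p1 p2 : Fin n → B) (q : Fin n → ℕ) (pp1 pp2 : (i : Fin n) → Fin (q i) → B)
    (m : ℕ) (r1 r2 : Fin m → C) (s : Fin m → ℕ) (rr1 rr2 : (j : Fin m) → Fin (s j) → C),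
    Coalgebra.comul (R := k) b' = ∑ i, p1 i ⊗ₜ[k] p2 i →
    (∀ i, Coalgebra.comul (R := k) (p2 i) = ∑ i', pp1 i i' ⊗ₜ[k] pp2 i i') →
    Coalgebra.comul (R := k) c = ∑ j, r1 j ⊗ₜ[k] r2 j →
    (∀ j, Coalgebra.comul (R := k) (r2 j) = ∑ j', rr1 j j' ⊗ₜ[k] rr2 j j') →
    mD ((b ⊗ₜ[k] c) ⊗ₜ[k] (b' ⊗ₜ[k] c'))
      = ∑ i, ∑ i', ∑ j, ∑ j',
          (ev (r1 j) (HopfAlgebra.antipode (R := k) (pp2 i i')) * ev (rr2 j j') (p1 i))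
            • ((b * pp1 i i') ⊗ₜ[k] (rr1 j j' * c'))

/-- `γ` is a right 2-cocycle on the Drinfeld double (with product `mD`): it is
convolution invertible, satisfies the right 2-cocycle identity, and is normalized. -/
def IsRightTwoCocycleOnDrin (mD : (B ⊗[k] C) ⊗[k] (B ⊗[k] C) →ₗ[k] B ⊗[k] C)
    (γ : (B ⊗[k] C) ⊗[k] (B ⊗[k] C) →ₗ[k] k) : Prop :=
  (∃ γinv : (B ⊗[k] C) ⊗[k] (B ⊗[k] C) →ₗ[k] k,
    ∀ (x y : B ⊗[k] C) (n m : ℕ) (x1 x2 : Fin n → B ⊗[k] C) (y1 y2 : Fin m → B ⊗[k] C),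
      DrinComul k B C x = ∑ i, x1 i ⊗ₜ[k] x2 i →
      DrinComul k B C y = ∑ j, y1 j ⊗ₜ[k] y2 j →
      (∑ i, ∑ j, γ (x1 i ⊗ₜ[k] y1 j) * γinv (x2 i ⊗ₜ[k] y2 j)
          = DrinCounit k B C x * DrinCounit k B C y) ∧
      (∑ i, ∑ j, γinv (x1 i ⊗ₜ[k] y1 j) * γ (x2 i ⊗ₜ[k] y2 j)
          = DrinCounit k B C x * DrinCounit k B C y)) ∧
  (∀ (x y z : B ⊗[k] C) (n m p : ℕ)
      (x1 x2 : Fin n → B ⊗[k] C) (y1 y2 : Fin m → B ⊗[k] C) (z1 z2 : Fin p → B ⊗[k] C),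
    DrinComul k B C x = ∑ i, x1 i ⊗ₜ[k] x2 i →
    DrinComul k B C y = ∑ j, y1 j ⊗ₜ[k] y2 j →
    DrinComul k B C z = ∑ s, z1 s ⊗ₜ[k] z2 s →
    ∑ j, ∑ s, γ (x ⊗ₜ[k] mD (y1 j ⊗ₜ[k] z1 s)) * γ (y2 j ⊗ₜ[k] z2 s)
      = ∑ i, ∑ j, γ (mD (x1 i ⊗ₜ[k] y1 j) ⊗ₜ[k] z) * γ (x2 i ⊗ₜ[k] y2 j)) ∧
  (∀ x : B ⊗[k] C, γ (x ⊗ₜ[k] ((1 : B) ⊗ₜ[k] (1 : C))) = DrinCounit k B C x) ∧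
  (∀ x : B ⊗[k] C, γ (((1 : B) ⊗ₜ[k] (1 : C)) ⊗ₜ[k] x) = DrinCounit k B C x)

/-- A comultiplicative matrix: `Δ t_ij = ∑ t_il ⊗ t_lj`, `ε t_ij = δ_ij`. -/
structure IsComat (k : Type) {H : Type} [Field k] [Ring H] [HopfAlgebra k H] {ι : Type} [Fintype ι]
    [DecidableEq ι] (t : ι → ι → H) : Prop where
  comul : ∀ i j, Coalgebra.comul (R := k) (t i j) = ∑ l, t i l ⊗ₜ[k] t l j
  counit : ∀ i j, Coalgebra.counit (R := k) (t i j) = if i = j then 1 else 0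

section
variable {H : Type} [Ring H] [HopfAlgebra k H]

theorem exists_finite_subcomodule (b : H) : ∃ V : Submodule k H, FiniteDimensional k V ∧ b ∈ V ∧
    ∀ v ∈ V, Coalgebra.comul (R := k) v ∈ LinearMap.range (LinearMap.rTensor H V.subtype) := by
  classical
  let f := Module.Basis.ofVectorSpace k H
  obtain ⟨e, he⟩ := TensorProduct.eq_repr_basis_right f (Coalgebra.comul (R := k) b)
  let V : Submodule k H := Submodule.span k (e '' (e.support : Set _))
  have hV : ∀ l, e l ∈ V := by
    intro l
    by_cases h : l ∈ e.support
    · exact Submodule.subset_span ⟨l, h, rfl⟩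
    · rw [Finsupp.notMem_support_iff.mp h]; exact V.zero_mem
  refine ⟨V, ?_, ?_, ?_⟩
  · exact FiniteDimensional.span_of_finite k (e.support.finite_toSet.image _)
  · have h := Coalgebra.lTensor_counit_comul (R := k) b
    rw [← he] at h
    have h2 := congrArg (TensorProduct.rid k H) h
    simp only [Finsupp.sum, map_sum, LinearMap.lTensor_tmul, TensorProduct.rid_tmul, one_smul] at h2
    rw [← h2]
    exact V.sum_mem fun i _ => V.smul_mem _ (hV i)
  · intro v hv
    induction hv using Submodule.span_induction with
    | zero => simp
    | add x y _ _ hx hy => rw [map_add]; exact Submodule.add_mem _ hx hy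
    | smul a x _ hx => rw [map_smul]; exact Submodule.smul_mem _ _ hx
    | mem x hx =>
      obtain ⟨l, hl, rfl⟩ := hx
      have key : (LinearMap.lTensor H ((TensorProduct.rid k H).toLinearMap ∘ₗ
            LinearMap.lTensor H (f.coord l))) ∘ₗ (TensorProduct.assoc k H H H).toLinearMap
          = (TensorProduct.rid k (H ⊗[k] H)).toLinearMap ∘ₗ
            LinearMap.lTensor (H ⊗[k] H) (f.coord l) := by
        ext x y z
        simp
      have h := Coalgebra.coassoc_apply (R := k) b
      have h2 := congrArg (LinearMap.lTensor H ((TensorProduct.rid k H).toLinearMap ∘ₗ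
            LinearMap.lTensor H (f.coord l))) h
      have h3 := LinearMap.congr_fun key (LinearMap.rTensor H Coalgebra.comul (Coalgebra.comul (R := k) b))
      simp only [LinearMap.comp_apply, LinearEquiv.coe_coe] at h3
      rw [h3, ← he] at h2
      simp only [Finsupp.sum, map_sum, LinearMap.lTensor_tmul, LinearMap.rTensor_tmul,
        TensorProduct.rid_tmul, Module.Basis.coord_apply, Module.Basis.repr_self,
        Finsupp.single_apply, ite_smul, one_smul, zero_smul] at h2
      rw [Finset.sum_ite_eq' , if_pos (by simpa using hl)] at h2
      rw [h2]
      exact Submodule.sum_mem _ fun i _ => ⟨(⟨e i, hV i⟩ : V) ⊗ₜ _, by simp; rfl⟩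

theorem exists_comat (b : H) : ∃ (n : ℕ) (t : Fin n → Fin n → H), IsComat k t ∧
    b ∈ Submodule.span k {x | ∃ i j, x = t i j} := by
  classical
  obtain ⟨V, hfin, hb, hV⟩ := exists_finite_subcomodule (k := k) b
  let v := Module.finBasis k V
  have hφ : ∀ j, ∃ φ : H →ₗ[k] k, φ ∘ₗ V.subtype = v.coord j := fun j =>
    LinearMap.exists_extend (v.coord j)
  choose φ hφ using hφ
  have hφv : ∀ j i, φ j (v i : H) = if i = j then 1 else 0 := by
    intro j i
    have := LinearMap.congr_fun (hφ j) (v i)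
    simpa [Finsupp.single_apply] using this
  have ht : ∀ l, ∃ t : Fin _ → H, Coalgebra.comul (R := k) (v l : H) = ∑ j, (v j : H) ⊗ₜ[k] t j := by
    intro l
    obtain ⟨w, hw⟩ := hV (v l) (v l).2
    obtain ⟨c, hc⟩ := TensorProduct.eq_repr_basis_left v w
    refine ⟨c, ?_⟩
    rw [← hw, ← hc, Finsupp.sum_fintype _ _ (by simp)]
    simp
  choose t' ht' using ht
  have hc : ∀ m l, Coalgebra.comul (R := k) (t' l m) = ∑ j, t' j m ⊗ₜ[k] t' l j := by
    intro m l
    have h := Coalgebra.coassoc_apply (R := k) (v l : H)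
    have h2 := congrArg (fun z => TensorProduct.lid k (H ⊗[k] H) (LinearMap.rTensor _ (φ m) z)) h
    simp only [ht', map_sum, LinearMap.rTensor_tmul, LinearMap.lTensor_tmul, TensorProduct.sum_tmul,
      TensorProduct.assoc_tmul, TensorProduct.lid_tmul, hφv, ite_smul, one_smul, zero_smul] at h2
    simpa using h2.symm
  have hε : ∀ m l, Coalgebra.counit (R := k) (t' l m) = if m = l then 1 else 0 := by
    intro m l
    have h := Coalgebra.lTensor_counit_comul (R := k) (v l : H)
    have h2 := congrArg (fun z => TensorProduct.rid k k (LinearMap.rTensor _ (φ m) z)) h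
    simp only [ht', map_sum, LinearMap.rTensor_tmul, LinearMap.lTensor_tmul,
      TensorProduct.rid_tmul, hφv] at h2
    simpa [eq_comm] using h2
  refine ⟨_, fun i j => t' j i, ⟨fun i j => hc i j, fun i j => hε i j⟩, ?_⟩
  have hv : ∀ l, (v l : H) ∈ Submodule.span k {x | ∃ i j, x = t' j i} := by
    intro l
    have h := Coalgebra.rTensor_counit_comul (R := k) (v l : H)
    have h2 := congrArg (TensorProduct.lid k H) h
    simp only [ht', map_sum, LinearMap.rTensor_tmul, TensorProduct.lid_tmul, one_smul] at h2
    rw [← h2]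
    exact Submodule.sum_mem _ fun i _ => Submodule.smul_mem _ _ (Submodule.subset_span ⟨i, l, rfl⟩)
  have := v.sum_repr ⟨b, hb⟩
  have h3 := congrArg V.subtype this
  simp only [map_sum, map_smul, Submodule.subtype_apply] at h3
  rw [← h3]
  exact Submodule.sum_mem _ fun i _ => Submodule.smul_mem _ _ (hv i)

/-- Two linear maps agreeing on entries of all comultiplicative matrices are equal. -/
theorem ext_comat {M : Type*} [AddCommGroup M] [Module k M] {f g : H →ₗ[k] M}
    (h : ∀ (n : ℕ) (t : Fin n → Fin n → H), IsComat k t → ∀ i j, f (t i j) = g (t i j)) :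
    f = g := by
  ext b
  obtain ⟨n, t, ht, hb⟩ := exists_comat (k := k) b
  induction hb using Submodule.span_induction with
  | zero => simp
  | add x y _ _ hx hy => simp [hx, hy]
  | smul a x _ hx => simp [hx]
  | mem x hx => obtain ⟨i, j, rfl⟩ := hx; exact h n t ht i j

variable {ι κ : Type} [Fintype ι] [DecidableEq ι] [Fintype κ] [DecidableEq κ]

theorem IsComat.mul {t : ι → ι → H} {u : κ → κ → H} (ht : IsComat k t) (hu : IsComat k u)
    (i i' : ι) (j j' : κ) : Coalgebra.comul (R := k) (t i i' * u j j')
      = ∑ p : ι × κ, (t i p.1 * u j p.2) ⊗ₜ[k] (t p.1 i' * u p.2 j') := by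
  rw [Bialgebra.comul_mul, ht.comul, hu.comul, Fintype.sum_prod_type]
  simp [Finset.sum_mul_sum]

theorem IsComat.antipode_mul {t : ι → ι → H} (ht : IsComat k t) (i j : ι) :
    ∑ l, HopfAlgebra.antipode (R := k) (t i l) * t l j = if i = j then 1 else 0 := by
  have := HopfAlgebra.mul_antipode_rTensor_comul_apply (R := k) (t i j)
  rw [ht.comul, ht.counit] at this
  simpa using this

theorem IsComat.mul_antipode {t : ι → ι → H} (ht : IsComat k t) (i j : ι) :
    ∑ l, t i l * HopfAlgebra.antipode (R := k) (t l j) = if i = j then 1 else 0 := by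
  have := HopfAlgebra.mul_antipode_lTensor_comul_apply (R := k) (t i j)
  rw [ht.comul, ht.counit] at this
  simpa using this

end

theorem sum_perm_ten {R b d g f x y i i' j j' : Type} [CommRing R] [Fintype b] [Fintype d] [Fintype g] [Fintype f]
    [Fintype x] [Fintype y] [Fintype i] [Fintype i'] [Fintype j] [Fintype j']
    (F : b → d → g → f → x → y → i → i' → j → j' → R) :
    ∑ b, ∑ d, ∑ g, ∑ f, ∑ x, ∑ y, ∑ i, ∑ i', ∑ j, ∑ j', F b d g f x y i i' j j'
    = ∑ b, ∑ j, ∑ j', ∑ i, ∑ i', ∑ f, ∑ x, ∑ y, ∑ d, ∑ g, F b d g f x y i i' j j' := by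
  simp only [← Fintype.sum_prod_type']
  exact Fintype.sum_equiv
    ⟨fun ⟨b, d, g, f, x, y, i, i', j, j'⟩ => ⟨b, j, j', i, i', f, x, y, d, g⟩,
     fun ⟨b, j, j', i, i', f, x, y, d, g⟩ => ⟨b, d, g, f, x, y, i, i', j, j'⟩,
     fun _ => rfl, fun _ => rfl⟩ _ _ fun _ => rfl

theorem scalar_contraction {R b g d f : Type} [CommRing R] [Fintype b] [Fintype d]
    [Fintype g] [Fintype f] (P : b → g → g → d → d → f → R) (E : d → g → R) (S : b → g → R)
    (T : d → f → R) (U : d → d → g → g → R) (W : d → d → g → g → R) :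
    ∑ b, ∑ d, ∑ g, ∑ f, (∑ i, ∑ i', ∑ j, ∑ j', (U d j i' g * E j' i) * P b i i' j j' f) *
      (∑ x, ∑ y, S b x * T y f * W y d g x)
    = ∑ b, ∑ j, ∑ j', ∑ i, ∑ i', ∑ f, ∑ x, ∑ y,
      P b i i' j j' f * E j' i * S b x * T y f * ∑ d, ∑ g, W y d g x * U d j i' g := by
  simp only [Finset.mul_sum, Finset.sum_mul]
  refine (sum_perm_ten _).trans ?_
  iterate 10 refine Finset.sum_congr rfl fun _ _ => ?_
  ring

section
variable {nA nB nG nC nD nF : ℕ}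
  {tA : Fin nA → Fin nA → B} {tB : Fin nB → Fin nB → B} {tG : Fin nG → Fin nG → B}
  {tC : Fin nC → Fin nC → C} {tD : Fin nD → Fin nD → C} {tF : Fin nF → Fin nF → C}

theorem ev_contract {ev : C →ₗ[k] B →ₗ[k] k} (hev : IsWeakHopfPairing ev)
    (hG : IsComat k tG) (hD : IsComat k tD) (d e : Fin nD) (g h : Fin nG) :
    ∑ d', ∑ g', ev (tD d d') (tG g' h) * ev (tD d' e) (HopfAlgebra.antipode (R := k) (tG g g'))
      = if d = e ∧ g = h then 1 else 0 := by
  rw [Finset.sum_comm]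
  have h1 : ∀ g', ∑ d', ev (tD d d') (tG g' h) *
      ev (tD d' e) (HopfAlgebra.antipode (R := k) (tG g g'))
      = ev (tD d e) (HopfAlgebra.antipode (R := k) (tG g g') * tG g' h) := by
    intro g'
    rw [hev.2.1 _ _ _ _ _ _ (hD.comul d e)]
  simp only [h1]
  rw [← map_sum, hG.antipode_mul]
  split_ifs with h2 h3 h3
  · rw [hev.2.2.2.1, hD.counit, if_pos h3.1]
  · rw [hev.2.2.2.1, hD.counit, if_neg (fun h => h3 ⟨h, h2⟩)]
  · exact absurd h3.2 h2
  · simp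

theorem ev_contract' {ev : C →ₗ[k] B →ₗ[k] k} (hev : IsWeakHopfPairing ev)
    (hG : IsComat k tG) (hD : IsComat k tD) (d e : Fin nD) (g h : Fin nG) :
    ∑ d', ∑ g', ev (tD d d') (HopfAlgebra.antipode (R := k) (tG g' h)) * ev (tD d' e) (tG g g')
      = if d = e ∧ g = h then 1 else 0 := by
  rw [Finset.sum_comm]
  have h1 : ∀ g', ∑ d', ev (tD d d') (HopfAlgebra.antipode (R := k) (tG g' h)) *
      ev (tD d' e) (tG g g')
      = ev (tD d e) (tG g g' * HopfAlgebra.antipode (R := k) (tG g' h)) := by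
    intro g'
    rw [hev.2.1 _ _ _ _ _ _ (hD.comul d e)]
  simp only [h1]
  rw [← map_sum, hG.mul_antipode]
  split_ifs with h2 h3 h3
  · rw [hev.2.2.2.1, hD.counit, if_pos h3.1]
  · rw [hev.2.2.2.1, hD.counit, if_neg (fun h => h3 ⟨h, h2⟩)]
  · exact absurd h3.2 h2
  · simp

theorem contraction {ev : C →ₗ[k] B →ₗ[k] k} (hev : IsWeakHopfPairing ev)
    {mD : (B ⊗[k] C) ⊗[k] (B ⊗[k] C) →ₗ[k] B ⊗[k] C} (hmD : IsDrinMul ev mD)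
    {σ : B ⊗[k] B →ₗ[k] k} {τ : C ⊗[k] C →ₗ[k] k}
    {st : (B ⊗[k] C) ⊗[k] (B ⊗[k] C) →ₗ[k] k}
    (hst : ∀ (b : B) (c : C) (b' : B) (c' : C)
        (n : ℕ) (p1 p2 : Fin n → B) (m : ℕ) (r1 r2 : Fin m → C),
      Coalgebra.comul (R := k) b' = ∑ i, p1 i ⊗ₜ[k] p2 i →
      Coalgebra.comul (R := k) c = ∑ j, r1 j ⊗ₜ[k] r2 j →
      st ((b ⊗ₜ[k] c) ⊗ₜ[k] (b' ⊗ₜ[k] c'))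
        = ∑ i, ∑ j, σ (b ⊗ₜ[k] p2 i) * τ (r1 j ⊗ₜ[k] c') * ev (r2 j) (p1 i))
    (hG : IsComat k tG) (hD : IsComat k tD) (φ : B ⊗[k] C →ₗ[k] k)
    (b0 b1 : Fin nB) (d0 d1 : Fin nD) (g0 g1 : Fin nG) (f0 f1 : Fin nF) :
    ∑ b, ∑ d, ∑ g, ∑ f,
      φ (mD ((tB b0 b ⊗ₜ tD d d1) ⊗ₜ (tG g0 g ⊗ₜ tF f f1))) *
        st ((tB b b1 ⊗ₜ tD d0 d) ⊗ₜ (tG g g1 ⊗ₜ tF f0 f))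
    = ∑ b, ∑ d, ∑ d', ∑ g, ∑ g', ∑ f,
      φ ((tB b0 b * tG g g') ⊗ₜ (tD d d' * tF f f1)) * ev (tD d' d1) (tG g0 g) *
        σ (tB b b1 ⊗ₜ tG g' g1) * τ (tD d0 d ⊗ₜ tF f0 f) := by
  have e1 : ∀ b d g f, φ (mD ((tB b0 b ⊗ₜ tD d d1) ⊗ₜ (tG g0 g ⊗ₜ tF f f1)))
      = ∑ i, ∑ i', ∑ j, ∑ j', (ev (tD d j) (HopfAlgebra.antipode (R := k) (tG i' g)) *
          ev (tD j' d1) (tG g0 i)) * φ ((tB b0 b * tG i i') ⊗ₜ (tD j j' * tF f f1)) := by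
    intro b d g f
    rw [hmD (tB b0 b) (tD d d1) (tG g0 g) (tF f f1) nG (fun i => tG g0 i) (fun i => tG i g)
      (fun _ => nG) (fun i i' => tG i i') (fun i i' => tG i' g) nD (fun i => tD d i)
      (fun i => tD i d1) (fun _ => nD) (fun i i' => tD i i') (fun i i' => tD i' d1)
      (hG.comul _ _) (fun i => hG.comul _ _) (hD.comul _ _) (fun i => hD.comul _ _)]
    simp
  have e2 : ∀ b d g f, st ((tB b b1 ⊗ₜ tD d0 d) ⊗ₜ (tG g g1 ⊗ₜ tF f0 f))
      = ∑ i, ∑ j, σ (tB b b1 ⊗ₜ tG i g1) * τ (tD d0 j ⊗ₜ tF f0 f) * ev (tD j d) (tG g i) :=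
    fun b d g f => hst _ _ _ _ _ _ _ _ _ _ (hG.comul _ _) (hD.comul _ _)
  simp only [e1, e2]
  have e3 : ∑ b, ∑ d, ∑ d', ∑ g, ∑ g', ∑ f,
      φ ((tB b0 b * tG g g') ⊗ₜ (tD d d' * tF f f1)) * ev (tD d' d1) (tG g0 g) *
        σ (tB b b1 ⊗ₜ tG g' g1) * τ (tD d0 d ⊗ₜ tF f0 f)
    = ∑ b, ∑ d, ∑ d', ∑ g, ∑ g', ∑ f, ∑ x, ∑ y,
      φ ((tB b0 b * tG g g') ⊗ₜ (tD d d' * tF f f1)) * ev (tD d' d1) (tG g0 g) *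
        σ (tB b b1 ⊗ₜ tG x g1) * τ (tD d0 y ⊗ₜ tF f0 f) *
        ∑ z, ∑ w, ev (tD y z) (tG w x) * ev (tD z d) (HopfAlgebra.antipode (R := k) (tG g' w)) := by
    simp only [ev_contract hev hG hD, mul_ite, mul_one, mul_zero, ite_and]
    simp
  rw [e3]
  exact scalar_contraction
    (fun b i i' j j' f => φ ((tB b0 b * tG i i') ⊗ₜ (tD j j' * tF f f1)))
    (fun j' i => ev (tD j' d1) (tG g0 i))
    (fun b x => σ (tB b b1 ⊗ₜ tG x g1))
    (fun y f => τ (tD d0 y ⊗ₜ tF f0 f))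
    (fun d j i' g => ev (tD d j) (HopfAlgebra.antipode (R := k) (tG i' g)))
    (fun y d g x => ev (tD y d) (tG g x))

end

theorem scalar_left {R α β γ δ φ : Type} [CommRing R] [Fintype α] [Fintype β] [Fintype γ]
    [Fintype δ] [Fintype φ]
    (S1 : β → β → γ → γ → R) (S2 : β → γ → R) (T1 : α → δ → δ → φ → R) (T2 : δ → φ → R)
    (E1 : α → α → γ → γ → R) (E2 : δ → γ → R) (E3 : α → β → R) :
    ∑ b, ∑ d, ∑ d', ∑ g, ∑ g', ∑ f,
      (∑ p : β × γ, ∑ c, S1 p.1 b p.2 g' * T1 c d d' f * ∑ c', E1 c c' g p.2 * E3 c' p.1)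
        * E2 d' g * S2 b g' * T2 d f
    = ∑ y, ∑ z, ∑ c, ∑ c', ∑ d', (∑ b, ∑ g', S1 y b z g' * S2 b g') *
        (∑ d, ∑ f, T1 c d d' f * T2 d f) * (∑ g, E1 c c' g z * E2 d' g) * E3 c' y := by
  simp only [Fintype.sum_prod_type]
  simp only [Finset.mul_sum, Finset.sum_mul]
  simp only [← Fintype.sum_prod_type']
  refine Fintype.sum_equiv
    ⟨fun ⟨b, d, d', g, g', f, y, z, c, c'⟩ => ⟨y, z, c, c', d', g, d, f, b, g'⟩,
     fun ⟨y, z, c, c', d', g, d, f, b, g'⟩ => ⟨b, d, d', g, g', f, y, z, c, c'⟩,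
     fun _ => rfl, fun _ => rfl⟩ _ _ ?_
  rintro ⟨b, d, d', g, g', f, y, z, c, c'⟩
  simp only [Equiv.coe_fn_mk]
  ring

theorem scalar_right {R α β γ δ φ : Type} [CommRing R] [Fintype α] [Fintype β] [Fintype γ]
    [Fintype δ] [Fintype φ]
    (S1 : φ → β → β → γ → R) (S2 : φ → β → R) (T1 : α → α → δ → δ → R) (T2 : α → δ → R)
    (E1 : α → α → δ → γ → R) (E3 : α → β → R) :
    ∑ a, ∑ c, ∑ c', ∑ b, ∑ b', ∑ d,
      (∑ z, ∑ p : α × δ, S1 a b b' z * T1 c p.1 d p.2 * E1 p.1 c' p.2 z)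
        * E3 c' b * S2 a b' * T2 c d
    = ∑ y, ∑ z, ∑ c, ∑ c', ∑ d', (∑ a, ∑ b, S1 a y b z * S2 a b) *
        (∑ x, ∑ d, T1 x c d d' * T2 x d) * E1 c c' d' z * E3 c' y := by
  simp only [Fintype.sum_prod_type]
  simp only [Finset.mul_sum, Finset.sum_mul]
  simp only [← Fintype.sum_prod_type']
  refine Fintype.sum_equiv
    ⟨fun ⟨a, c, c', b, b', d, z, p, q⟩ => ⟨b, z, p, c', q, c, d, a, b'⟩,
     fun ⟨b, z, p, c', q, c, d, a, b'⟩ => ⟨a, c, c', b, b', d, z, p, q⟩,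
     fun _ => rfl, fun _ => rfl⟩ _ _ ?_
  rintro ⟨a, c, c', b, b', d, z, p, q⟩
  simp only [Equiv.coe_fn_mk]
  ring

theorem ext_drin {M : Type*} [AddCommGroup M] [Module k M] {f g : B ⊗[k] C →ₗ[k] M}
    (h : ∀ (n : ℕ) (t : Fin n → Fin n → B), IsComat k t → ∀ (m : ℕ) (u : Fin m → Fin m → C),
      IsComat k u → ∀ i j i' j', f (t i j ⊗ₜ u i' j') = g (t i j ⊗ₜ u i' j')) : f = g :=
  TensorProduct.ext (ext_comat fun n t ht i j => ext_comat fun m u hu i' j' =>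
    h n t ht m u hu i j i' j')

theorem drinComul_comat {n m : ℕ} {t : Fin n → Fin n → B} {u : Fin m → Fin m → C}
    (ht : IsComat k t) (hu : IsComat k u) (i j : Fin n) (i' j' : Fin m) :
    DrinComul k B C (t i j ⊗ₜ u i' j')
      = ∑ p : Fin n × Fin m,
        (t i p.1 ⊗ₜ[k] u p.2 j') ⊗ₜ[k] (t p.1 j ⊗ₜ[k] u i' p.2) := by
  rw [Fintype.sum_prod_type, Finset.sum_comm]
  simp [DrinComul, ht.comul, hu.comul, TensorProduct.sum_tmul, TensorProduct.tmul_sum]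

theorem drinCounit_comat {n m : ℕ} {t : Fin n → Fin n → B} {u : Fin m → Fin m → C}
    (ht : IsComat k t) (hu : IsComat k u) (i j : Fin n) (i' j' : Fin m) :
    DrinCounit k B C (t i j ⊗ₜ u i' j') = (if i = j then 1 else 0) * if i' = j' then 1 else 0 := by
  simp only [DrinCounit, LinearMap.comp_apply, TensorProduct.map_tmul, LinearMap.mul'_apply,
    ht.counit, hu.counit]

/-- Convolution product of two functionals on `D ⊗ D`. -/
def drinConv (f g : (B ⊗[k] C) ⊗[k] (B ⊗[k] C) →ₗ[k] k) :
    (B ⊗[k] C) ⊗[k] (B ⊗[k] C) →ₗ[k] k :=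
  LinearMap.mul' k k ∘ₗ TensorProduct.map f g ∘ₗ
    (TensorProduct.tensorTensorTensorComm k (B ⊗[k] C) (B ⊗[k] C) (B ⊗[k] C)
      (B ⊗[k] C)).toLinearMap ∘ₗ TensorProduct.map (DrinComul k B C) (DrinComul k B C)

theorem drinConv_apply (f g : (B ⊗[k] C) ⊗[k] (B ⊗[k] C) →ₗ[k] k)
    {ι κ : Type} [Fintype ι] [Fintype κ] (x y : B ⊗[k] C) (x1 x2 : ι → B ⊗[k] C)
    (y1 y2 : κ → B ⊗[k] C)
    (hx : DrinComul k B C x = ∑ i, x1 i ⊗ₜ[k] x2 i)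
    (hy : DrinComul k B C y = ∑ j, y1 j ⊗ₜ[k] y2 j) :
    drinConv f g (x ⊗ₜ y) = ∑ i, ∑ j, f (x1 i ⊗ₜ[k] y1 j) * g (x2 i ⊗ₜ[k] y2 j) := by
  simp only [drinConv, LinearMap.comp_apply, TensorProduct.map_tmul, hx, hy,
    TensorProduct.sum_tmul, TensorProduct.tmul_sum, map_sum, LinearEquiv.coe_coe,
    TensorProduct.tensorTensorTensorComm_tmul, LinearMap.mul'_apply]
  rw [Finset.sum_comm]

/-- Left side of the cocycle identity. -/
def cocL (mD : (B ⊗[k] C) ⊗[k] (B ⊗[k] C) →ₗ[k] B ⊗[k] C)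
    (st : (B ⊗[k] C) ⊗[k] (B ⊗[k] C) →ₗ[k] k) :
    ((B ⊗[k] C) ⊗[k] (B ⊗[k] C)) ⊗[k] (B ⊗[k] C) →ₗ[k] k :=
  LinearMap.mul' k k ∘ₗ TensorProduct.map (st ∘ₗ LinearMap.lTensor _ mD) st ∘ₗ
    (TensorProduct.assoc k (B ⊗[k] C) ((B ⊗[k] C) ⊗[k] (B ⊗[k] C))
      ((B ⊗[k] C) ⊗[k] (B ⊗[k] C))).symm.toLinearMap ∘ₗ
    LinearMap.lTensor (B ⊗[k] C)
      ((TensorProduct.tensorTensorTensorComm k (B ⊗[k] C) (B ⊗[k] C) (B ⊗[k] C)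
      (B ⊗[k] C)).toLinearMap ∘ₗ TensorProduct.map (DrinComul k B C) (DrinComul k B C)) ∘ₗ
    (TensorProduct.assoc k (B ⊗[k] C) (B ⊗[k] C) (B ⊗[k] C)).toLinearMap

theorem cocL_apply (mD : (B ⊗[k] C) ⊗[k] (B ⊗[k] C) →ₗ[k] B ⊗[k] C)
    (st : (B ⊗[k] C) ⊗[k] (B ⊗[k] C) →ₗ[k] k)
    {ι κ : Type} [Fintype ι] [Fintype κ] (x y z : B ⊗[k] C) (y1 y2 : ι → B ⊗[k] C)
    (z1 z2 : κ → B ⊗[k] C)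
    (hy : DrinComul k B C y = ∑ i, y1 i ⊗ₜ[k] y2 i)
    (hz : DrinComul k B C z = ∑ j, z1 j ⊗ₜ[k] z2 j) :
    cocL mD st ((x ⊗ₜ y) ⊗ₜ z)
      = ∑ j, ∑ s, st (x ⊗ₜ[k] mD (y1 j ⊗ₜ[k] z1 s)) * st (y2 j ⊗ₜ[k] z2 s) := by
  simp only [cocL, LinearMap.comp_apply, TensorProduct.map_tmul, hy, hz,
    TensorProduct.sum_tmul, TensorProduct.tmul_sum, map_sum, LinearEquiv.coe_coe,
    TensorProduct.tensorTensorTensorComm_tmul, LinearMap.mul'_apply, TensorProduct.assoc_tmul,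
    TensorProduct.assoc_symm_tmul, LinearMap.lTensor_tmul]
  rw [Finset.sum_comm]

/-- Right side of the cocycle identity. -/
def cocR (mD : (B ⊗[k] C) ⊗[k] (B ⊗[k] C) →ₗ[k] B ⊗[k] C)
    (st : (B ⊗[k] C) ⊗[k] (B ⊗[k] C) →ₗ[k] k) :
    ((B ⊗[k] C) ⊗[k] (B ⊗[k] C)) ⊗[k] (B ⊗[k] C) →ₗ[k] k :=
  LinearMap.mul' k k ∘ₗ TensorProduct.map (st ∘ₗ LinearMap.rTensor _ mD) st ∘ₗ
    (TensorProduct.rightComm k ((B ⊗[k] C) ⊗[k] (B ⊗[k] C))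
      ((B ⊗[k] C) ⊗[k] (B ⊗[k] C)) (B ⊗[k] C)).toLinearMap ∘ₗ
    LinearMap.rTensor (B ⊗[k] C)
      ((TensorProduct.tensorTensorTensorComm k (B ⊗[k] C) (B ⊗[k] C) (B ⊗[k] C)
      (B ⊗[k] C)).toLinearMap ∘ₗ TensorProduct.map (DrinComul k B C) (DrinComul k B C))

theorem cocR_apply (mD : (B ⊗[k] C) ⊗[k] (B ⊗[k] C) →ₗ[k] B ⊗[k] C)
    (st : (B ⊗[k] C) ⊗[k] (B ⊗[k] C) →ₗ[k] k)
    {ι κ : Type} [Fintype ι] [Fintype κ] (x y z : B ⊗[k] C) (x1 x2 : ι → B ⊗[k] C)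
    (y1 y2 : κ → B ⊗[k] C)
    (hx : DrinComul k B C x = ∑ i, x1 i ⊗ₜ[k] x2 i)
    (hy : DrinComul k B C y = ∑ j, y1 j ⊗ₜ[k] y2 j) :
    cocR mD st ((x ⊗ₜ y) ⊗ₜ z)
      = ∑ i, ∑ j, st (mD (x1 i ⊗ₜ[k] y1 j) ⊗ₜ[k] z) * st (x2 i ⊗ₜ[k] y2 j) := by
  simp only [cocR, LinearMap.comp_apply, TensorProduct.map_tmul, hx, hy,
    TensorProduct.sum_tmul, TensorProduct.tmul_sum, map_sum, LinearEquiv.coe_coe,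
    TensorProduct.tensorTensorTensorComm_tmul, LinearMap.mul'_apply,
    TensorProduct.rightComm_tmul, LinearMap.rTensor_tmul]
  rw [Finset.sum_comm]

/-- The convolution inverse of `σ∘τ`:
`(b⊗c)⊗(b'⊗c') ↦ σinv(b⊗b'₍₁₎) τinv(c₍₂₎⊗c') ev(c₍₁₎, S b'₍₂₎)`. -/
def stInv (ev : C →ₗ[k] B →ₗ[k] k) (σ : B ⊗[k] B →ₗ[k] k) (τ : C ⊗[k] C →ₗ[k] k) :
    (B ⊗[k] C) ⊗[k] (B ⊗[k] C) →ₗ[k] k :=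
  LinearMap.mul' k k ∘ₗ
  TensorProduct.map σ (LinearMap.mul' k k ∘ₗ TensorProduct.map τ
    (TensorProduct.lift (ev.compl₂ (HopfAlgebra.antipode (R := k)))) ∘ₗ
    (TensorProduct.tensorTensorTensorComm k C C C B).toLinearMap) ∘ₗ
  (TensorProduct.tensorTensorTensorComm k B (C ⊗[k] C) B (C ⊗[k] B)).toLinearMap ∘ₗ
  TensorProduct.map
    (LinearMap.lTensor B ((TensorProduct.comm k C C).toLinearMap ∘ₗ Coalgebra.comul (R := k)))
    (LinearMap.lTensor B (TensorProduct.comm k B C).toLinearMap ∘ₗ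
      (TensorProduct.assoc k B B C).toLinearMap ∘ₗ
      LinearMap.rTensor C (Coalgebra.comul (R := k)))

theorem stInv_comat (ev : C →ₗ[k] B →ₗ[k] k) (σ : B ⊗[k] B →ₗ[k] k) (τ : C ⊗[k] C →ₗ[k] k)
    {n m : ℕ} {t : Fin n → Fin n → B} {u : Fin m → Fin m → C}
    (ht : IsComat k t) (hu : IsComat k u) (b : B) (c' : C) (i j : Fin n) (i' j' : Fin m) :
    stInv ev σ τ ((b ⊗ₜ u i' j') ⊗ₜ (t i j ⊗ₜ c')) = ∑ l, ∑ q, σ (b ⊗ₜ t i l) *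
      τ (u q j' ⊗ₜ c') * ev (u i' q) (HopfAlgebra.antipode (R := k) (t l j)) := by
  simp only [stInv, LinearMap.comp_apply, TensorProduct.map_tmul, ht.comul, hu.comul,
    TensorProduct.sum_tmul, TensorProduct.tmul_sum, map_sum, LinearEquiv.coe_coe,
    TensorProduct.tensorTensorTensorComm_tmul, LinearMap.mul'_apply, TensorProduct.assoc_tmul,
    LinearMap.rTensor_tmul, LinearMap.lTensor_tmul, TensorProduct.comm_tmul,
    TensorProduct.lift.tmul, LinearMap.compl₂_apply, mul_assoc]

theorem scalar_conv_one {R b c g f : Type} [CommRing R] [Fintype b] [Fintype c] [Fintype g]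
    [Fintype f] (S S' : b → g → g → R) (T T' : c → c → f → R) (E E' : c → g → R) :
    ∑ p : b × c, ∑ r : g × f, (∑ i, ∑ j, S p.1 i r.1 * T p.2 j r.2 * E j i) *
      (∑ l, ∑ q, S' p.1 r.1 l * T' q p.2 r.2 * E' q l)
    = ∑ i, ∑ j, ∑ l, ∑ q, (∑ b, ∑ g, S b i g * S' b g l) * (∑ c, ∑ f, T' q c f * T c j f) *
      E j i * E' q l := by
  simp only [Fintype.sum_prod_type]
  simp only [Finset.mul_sum, Finset.sum_mul]
  simp only [← Fintype.sum_prod_type']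
  refine Fintype.sum_equiv
    ⟨fun ⟨b, c, g, f, l, q, i, j⟩ => ⟨i, j, l, q, c, f, b, g⟩,
     fun ⟨i, j, l, q, c, f, b, g⟩ => ⟨b, c, g, f, l, q, i, j⟩,
     fun _ => rfl, fun _ => rfl⟩ _ _ ?_
  rintro ⟨b, c, g, f, l, q, i, j⟩
  simp only [Equiv.coe_fn_mk]
  ring

theorem scalar_conv_two {R b c g f : Type} [CommRing R] [Fintype b] [Fintype c] [Fintype g]
    [Fintype f] (S S' : b → g → R) (T T' : c → f → R) (E E' : c → c → g → g → R) :
    ∑ p : b × c, ∑ r : g × f, (∑ l, ∑ q, S' p.1 l * T' q r.2 * E' p.2 q l r.1) *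
      (∑ i, ∑ j, S p.1 i * T j r.2 * E j p.2 r.1 i)
    = ∑ i, ∑ j, ∑ l, ∑ q, (∑ b, S' b l * S b i) * (∑ f, T j f * T' q f) *
      ∑ c, ∑ g, E j c g i * E' c q l g := by
  simp only [Fintype.sum_prod_type]
  simp only [Finset.mul_sum, Finset.sum_mul]
  simp only [← Fintype.sum_prod_type']
  refine Fintype.sum_equiv
    ⟨fun ⟨b, c, g, f, i, j, l, q⟩ => ⟨i, j, l, q, c, g, f, b⟩,
     fun ⟨i, j, l, q, c, g, f, b⟩ => ⟨b, c, g, f, i, j, l, q⟩,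
     fun _ => rfl, fun _ => rfl⟩ _ _ ?_
  rintro ⟨b, c, g, f, i, j, l, q⟩
  simp only [Equiv.coe_fn_mk]
  ring

theorem st_fintype {ev : C →ₗ[k] B →ₗ[k] k}
    {σ : B ⊗[k] B →ₗ[k] k} {τ : C ⊗[k] C →ₗ[k] k}
    {st : (B ⊗[k] C) ⊗[k] (B ⊗[k] C) →ₗ[k] k}
    (hst : ∀ (b : B) (c : C) (b' : B) (c' : C)
        (n : ℕ) (p1 p2 : Fin n → B) (m : ℕ) (r1 r2 : Fin m → C),
      Coalgebra.comul (R := k) b' = ∑ i, p1 i ⊗ₜ[k] p2 i →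
      Coalgebra.comul (R := k) c = ∑ j, r1 j ⊗ₜ[k] r2 j →
      st ((b ⊗ₜ[k] c) ⊗ₜ[k] (b' ⊗ₜ[k] c'))
        = ∑ i, ∑ j, σ (b ⊗ₜ[k] p2 i) * τ (r1 j ⊗ₜ[k] c') * ev (r2 j) (p1 i))
    {ι κ : Type} [Fintype ι] [Fintype κ] (b : B) (c : C) (b' : B) (c' : C)
    (p1 p2 : ι → B) (r1 r2 : κ → C)
    (hb : Coalgebra.comul (R := k) b' = ∑ i, p1 i ⊗ₜ[k] p2 i)
    (hc : Coalgebra.comul (R := k) c = ∑ j, r1 j ⊗ₜ[k] r2 j) :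
    st ((b ⊗ₜ[k] c) ⊗ₜ[k] (b' ⊗ₜ[k] c'))
      = ∑ i, ∑ j, σ (b ⊗ₜ[k] p2 i) * τ (r1 j ⊗ₜ[k] c') * ev (r2 j) (p1 i) := by
  have e := (Fintype.equivFin ι).symm
  have e' := (Fintype.equivFin κ).symm
  rw [hst b c b' c' _ (p1 ∘ e) (p2 ∘ e) _ (r1 ∘ e') (r2 ∘ e')
    (by rw [hb]; exact (Equiv.sum_comp e (fun i => p1 i ⊗ₜ[k] p2 i)).symm)
    (by rw [hc]; exact (Equiv.sum_comp e' (fun i => r1 i ⊗ₜ[k] r2 i)).symm)]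
  rw [← Equiv.sum_comp e]
  refine Finset.sum_congr rfl fun i _ => ?_
  rw [← Equiv.sum_comp e']
  rfl

theorem sigma_circ_tau_is_two_cocycle_on_drinfeld_double
    (ev : C →ₗ[k] B →ₗ[k] k) (hev : IsWeakHopfPairing ev)
    (mD : (B ⊗[k] C) ⊗[k] (B ⊗[k] C) →ₗ[k] B ⊗[k] C) (hmD : IsDrinMul ev mD)
    -- `σ` is a right 2-cocycle on `B`
    (σ : B ⊗[k] B →ₗ[k] k)
    (σinv : B ⊗[k] B →ₗ[k] k)
    (hσconv : ∀ (a b : B) (n m : ℕ) (a1 a2 : Fin n → B) (b1 b2 : Fin m → B),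
      Coalgebra.comul (R := k) a = ∑ i, a1 i ⊗ₜ[k] a2 i →
      Coalgebra.comul (R := k) b = ∑ j, b1 j ⊗ₜ[k] b2 j →
      (∑ i, ∑ j, σ (a1 i ⊗ₜ[k] b1 j) * σinv (a2 i ⊗ₜ[k] b2 j)
          = Coalgebra.counit (R := k) a * Coalgebra.counit (R := k) b) ∧
      (∑ i, ∑ j, σinv (a1 i ⊗ₜ[k] b1 j) * σ (a2 i ⊗ₜ[k] b2 j)
          = Coalgebra.counit (R := k) a * Coalgebra.counit (R := k) b))
    (hσcocycle : ∀ (h g l : B) (m p : ℕ) (g1 g2 : Fin m → B) (l1 l2 : Fin p → B),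
      Coalgebra.comul (R := k) g = ∑ j, g1 j ⊗ₜ[k] g2 j →
      Coalgebra.comul (R := k) l = ∑ s, l1 s ⊗ₜ[k] l2 s →
      ∀ (n : ℕ) (h1 h2 : Fin n → B),
      Coalgebra.comul (R := k) h = ∑ i, h1 i ⊗ₜ[k] h2 i →
      ∑ j, ∑ s, σ (h ⊗ₜ[k] (g1 j * l1 s)) * σ (g2 j ⊗ₜ[k] l2 s)
        = ∑ i, ∑ j, σ ((h1 i * g1 j) ⊗ₜ[k] l) * σ (h2 i ⊗ₜ[k] g2 j))
    (hσ1 : ∀ h : B, σ (h ⊗ₜ[k] (1 : B)) = Coalgebra.counit (R := k) h)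
    (hσ1' : ∀ h : B, σ ((1 : B) ⊗ₜ[k] h) = Coalgebra.counit (R := k) h)
    -- `τ` is a left 2-cocycle on `C`
    (τ : C ⊗[k] C →ₗ[k] k)
    (τinv : C ⊗[k] C →ₗ[k] k)
    (hτconv : ∀ (a b : C) (n m : ℕ) (a1 a2 : Fin n → C) (b1 b2 : Fin m → C),
      Coalgebra.comul (R := k) a = ∑ i, a1 i ⊗ₜ[k] a2 i →
      Coalgebra.comul (R := k) b = ∑ j, b1 j ⊗ₜ[k] b2 j →
      (∑ i, ∑ j, τ (a1 i ⊗ₜ[k] b1 j) * τinv (a2 i ⊗ₜ[k] b2 j)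
          = Coalgebra.counit (R := k) a * Coalgebra.counit (R := k) b) ∧
      (∑ i, ∑ j, τinv (a1 i ⊗ₜ[k] b1 j) * τ (a2 i ⊗ₜ[k] b2 j)
          = Coalgebra.counit (R := k) a * Coalgebra.counit (R := k) b))
    (hτcocycle : ∀ (h g l : C) (m p : ℕ) (g1 g2 : Fin m → C) (l1 l2 : Fin p → C),
      Coalgebra.comul (R := k) g = ∑ j, g1 j ⊗ₜ[k] g2 j →
      Coalgebra.comul (R := k) l = ∑ s, l1 s ⊗ₜ[k] l2 s →
      ∀ (n : ℕ) (h1 h2 : Fin n → C),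
      Coalgebra.comul (R := k) h = ∑ i, h1 i ⊗ₜ[k] h2 i →
      ∑ j, ∑ s, τ (h ⊗ₜ[k] (g2 j * l2 s)) * τ (g1 j ⊗ₜ[k] l1 s)
        = ∑ i, ∑ j, τ ((h2 i * g2 j) ⊗ₜ[k] l) * τ (h1 i ⊗ₜ[k] g1 j))
    (hτ1 : ∀ c : C, τ (c ⊗ₜ[k] (1 : C)) = Coalgebra.counit (R := k) c)
    (hτ1' : ∀ c : C, τ ((1 : C) ⊗ₜ[k] c) = Coalgebra.counit (R := k) c)
    -- `st = σ ∘ τ` : `(σ∘τ)((b⊗c)⊗(b'⊗c')) = σ(b⊗b'₍₂₎) τ(c₍₁₎⊗c') ev(c₍₂₎, b'₍₁₎)`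
    (st : (B ⊗[k] C) ⊗[k] (B ⊗[k] C) →ₗ[k] k)
    (hst : ∀ (b : B) (c : C) (b' : B) (c' : C)
        (n : ℕ) (p1 p2 : Fin n → B) (m : ℕ) (r1 r2 : Fin m → C),
      Coalgebra.comul (R := k) b' = ∑ i, p1 i ⊗ₜ[k] p2 i →
      Coalgebra.comul (R := k) c = ∑ j, r1 j ⊗ₜ[k] r2 j →
      st ((b ⊗ₜ[k] c) ⊗ₜ[k] (b' ⊗ₜ[k] c'))
        = ∑ i, ∑ j, σ (b ⊗ₜ[k] p2 i) * τ (r1 j ⊗ₜ[k] c') * ev (r2 j) (p1 i)) :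
    IsRightTwoCocycleOnDrin mD st := by
  have hst' := @st_fintype k B C _ _ _ _ _ ev σ τ st hst
  refine ⟨⟨stInv ev σinv τinv, ?_⟩, ?_, ?_, ?_⟩
  · have h1 : drinConv st (stInv ev σinv τinv) =
        LinearMap.mul' k k ∘ₗ TensorProduct.map (DrinCounit k B C) (DrinCounit k B C) := by
      refine TensorProduct.ext (ext_drin fun nB tB hB nC tC hC b0 b1 c0 c1 =>
        ext_drin fun nG tG hG nF tF hF g0 g1 f0 f1 => ?_)
      simp only [LinearMap.compr₂ₛₗ_apply, TensorProduct.mk_apply, LinearMap.comp_apply,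
        TensorProduct.map_tmul, LinearMap.mul'_apply]
      rw [drinCounit_comat hB hC, drinCounit_comat hG hF,
        drinConv_apply _ _ _ _ _ _ _ _ (drinComul_comat hB hC _ _ _ _)
        (drinComul_comat hG hF _ _ _ _)]
      simp only [stInv_comat ev σinv τinv hG hC]
      have est : ∀ b c c' g g' f, st ((b ⊗ₜ tC c c') ⊗ₜ (tG g g' ⊗ₜ f)) = _ :=
        fun b c c' g g' f => hst' b _ _ f _ _ _ _ (hG.comul g g') (hC.comul c c')
      simp only [est]
      refine (scalar_conv_one (fun b i g => σ (tB b0 b ⊗ₜ tG i g))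
        (fun b g l => σinv (tB b b1 ⊗ₜ tG g l))
        (fun c j f => τ (tC c j ⊗ₜ tF f f1)) (fun q c f => τinv (tC q c ⊗ₜ tF f0 f))
        (fun j i => ev (tC j c1) (tG g0 i))
        (fun q l => ev (tC c0 q) (HopfAlgebra.antipode (R := k) (tG l g1)))).trans ?_
      have e1 : ∀ i l, ∑ b, ∑ g, σ (tB b0 b ⊗ₜ tG i g) * σinv (tB b b1 ⊗ₜ tG g l)
          = (if b0 = b1 then 1 else 0) * if i = l then 1 else 0 := fun i l => by
        rw [(hσconv _ _ _ _ _ _ _ _ (hB.comul _ _) (hG.comul _ _)).1, hB.counit, hG.counit]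
      have e2 : ∀ q j, ∑ c, ∑ f, τinv (tC q c ⊗ₜ tF f0 f) * τ (tC c j ⊗ₜ tF f f1)
          = (if q = j then 1 else 0) * if f0 = f1 then 1 else 0 := fun q j => by
        rw [(hτconv _ _ _ _ _ _ _ _ (hC.comul _ _) (hF.comul _ _)).2, hC.counit, hF.counit]
      simp only [e1, e2]
      have e3 := ev_contract' hev hG hC c0 c1 g0 g1
      rw [Finset.sum_comm] at e3
      calc _ = ∑ i, ∑ j, ((if b0 = b1 then 1 else 0) * (if f0 = f1 then 1 else 0)) *
            (ev (tC c0 j) (HopfAlgebra.antipode (R := k) (tG i g1)) * ev (tC j c1) (tG g0 i)) := by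
            refine Finset.sum_congr rfl fun i _ => Finset.sum_congr rfl fun j _ => ?_
            rw [Finset.sum_eq_single i, Finset.sum_eq_single j]
            · simp; ring_nf
            · intro q _ hq; simp [hq]
            · simp
            · intro q _ hq; simp [hq.symm]
            · simp
        _ = _ := by
            simp only [← Finset.mul_sum]
            rw [e3, ite_and]
            split_ifs <;> simp
    have h2 : drinConv (stInv ev σinv τinv) st =
        LinearMap.mul' k k ∘ₗ TensorProduct.map (DrinCounit k B C) (DrinCounit k B C) := by
      refine TensorProduct.ext (ext_drin fun nB tB hB nC tC hC b0 b1 c0 c1 =>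
        ext_drin fun nG tG hG nF tF hF g0 g1 f0 f1 => ?_)
      simp only [LinearMap.compr₂ₛₗ_apply, TensorProduct.mk_apply, LinearMap.comp_apply,
        TensorProduct.map_tmul, LinearMap.mul'_apply]
      rw [drinCounit_comat hB hC, drinCounit_comat hG hF,
        drinConv_apply _ _ _ _ _ _ _ _ (drinComul_comat hB hC _ _ _ _)
        (drinComul_comat hG hF _ _ _ _)]
      simp only [stInv_comat ev σinv τinv hG hC]
      have est : ∀ b c c' g g' f, st ((b ⊗ₜ tC c c') ⊗ₜ (tG g g' ⊗ₜ f)) = _ :=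
        fun b c c' g g' f => hst' b _ _ f _ _ _ _ (hG.comul g g') (hC.comul c c')
      simp only [est]
      refine (scalar_conv_two (fun b i => σ (tB b b1 ⊗ₜ tG i g1))
        (fun b l => σinv (tB b0 b ⊗ₜ tG g0 l))
        (fun j f => τ (tC c0 j ⊗ₜ tF f0 f)) (fun q f => τinv (tC q c1 ⊗ₜ tF f f1))
        (fun j c g i => ev (tC j c) (tG g i))
        (fun c q l g => ev (tC c q) (HopfAlgebra.antipode (R := k) (tG l g)))).trans ?_
      simp only [ev_contract hev hG hC]
      have e1 := (hσconv _ _ _ _ _ _ _ _ (hB.comul b0 b1) (hG.comul g0 g1)).2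
      have e2 := (hτconv _ _ _ _ _ _ _ _ (hC.comul c0 c1) (hF.comul f0 f1)).1
      rw [hB.counit, hG.counit, Finset.sum_comm] at e1
      rw [hC.counit, hF.counit] at e2
      calc _ = ∑ i, ∑ j, (∑ b, σinv (tB b0 b ⊗ₜ tG g0 i) * σ (tB b b1 ⊗ₜ tG i g1)) *
            (∑ f, τ (tC c0 j ⊗ₜ tF f0 f) * τinv (tC j c1 ⊗ₜ tF f f1)) := by
            refine Finset.sum_congr rfl fun i _ => Finset.sum_congr rfl fun j _ => ?_
            rw [Finset.sum_eq_single i, Finset.sum_eq_single j]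
            · simp
            · intro q _ hq; simp [hq.symm]
            · simp
            · intro q _ hq; simp [hq]
            · simp
        _ = _ := by
            rw [← Finset.sum_mul_sum, e1, e2]
            ring
    intro x y n m x1 x2 y1 y2 hx hy
    rw [← drinConv_apply st _ x y x1 x2 y1 y2 hx hy, ← drinConv_apply _ st x y x1 x2 y1 y2 hx hy,
      h1, h2]
    exact ⟨rfl, rfl⟩
  · have h : cocL mD st = cocR mD st := by
      refine TensorProduct.ext (TensorProduct.ext (ext_drin fun nA tA hA nC tC hC a0 a1 c0 c1 =>
        ext_drin fun nB tB hB nD tD hD b0 b1 d0 d1 =>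
        ext_drin fun nG tG hG nF tF hF g0 g1 f0 f1 => ?_))
      simp only [LinearMap.compr₂ₛₗ_apply, TensorProduct.mk_apply]
      rw [cocL_apply _ _ _ _ _ _ _ _ _ (drinComul_comat hB hD _ _ _ _)
        (drinComul_comat hG hF _ _ _ _), cocR_apply _ _ _ _ _ _ _ _ _
        (drinComul_comat hA hC _ _ _ _) (drinComul_comat hB hD _ _ _ _)]
      simp only [Fintype.sum_prod_type]
      refine (contraction (tB := tB) (tF := tF) hev hmD hst hG hD
        (st ∘ₗ TensorProduct.mk k _ _ (tA a0 a1 ⊗ₜ tC c0 c1)) b0 b1 d0 d1 g0 g1 f0 f1).trans ?_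
      refine Eq.trans ?_ (contraction (tB := tA) (tF := tD) hev hmD hst hB hC
        (st ∘ₗ (TensorProduct.mk k _ _).flip (tG g0 g1 ⊗ₜ tF f0 f1))
        a0 a1 c0 c1 b0 b1 d0 d1).symm
      simp only [LinearMap.comp_apply, TensorProduct.mk_apply, LinearMap.flip_apply]
      have est : ∀ b c c' i i' g g' f,
          st ((b ⊗ₜ tC c c') ⊗ₜ ((tB i i' * tG g g') ⊗ₜ f)) = _ :=
        fun b c c' i i' g g' f => hst' b _ _ f _ _ _ _ (hB.mul hG i i' g g') (hC.comul c c')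
      have est2 : ∀ b c c' d d' g g' f,
          st ((b ⊗ₜ (tC c c' * tD d d')) ⊗ₜ (tG g g' ⊗ₜ f)) = _ :=
        fun b c c' d d' g g' f => hst' b _ _ f _ _ _ _ (hG.comul g g') (hC.mul hD c c' d d')
      have eev : ∀ c c' b b', ev (tC c c') (b * b') = _ :=
        fun c c' b b' => hev.2.1 _ b b' _ _ _ (hC.comul c c')
      simp only [est, est2]
      simp only [eev]
      refine (scalar_left
        (fun y b z g' => σ (tA a0 a1 ⊗ₜ (tB y b * tG z g')))
        (fun b g' => σ (tB b b1 ⊗ₜ tG g' g1))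
        (fun c d d' f => τ (tC c0 c ⊗ₜ (tD d d' * tF f f1)))
        (fun d f => τ (tD d0 d ⊗ₜ tF f0 f))
        (fun c c' g z => ev (tC c c') (tG g z))
        (fun d' g => ev (tD d' d1) (tG g0 g))
        (fun c' y => ev (tC c' c1) (tB b0 y))).trans ?_
      refine Eq.trans ?_ (scalar_right
        (fun a b b' z => σ ((tA a0 a * tB b b') ⊗ₜ tG z g1))
        (fun a b' => σ (tA a a1 ⊗ₜ tB b' b1))
        (fun c p d q => τ ((tC c p * tD d q) ⊗ₜ tF f0 f1))
        (fun c d => τ (tC c0 c ⊗ₜ tD d0 d))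
        (fun p c' q z => ev (tC p c' * tD q d1) (tG g0 z))
        (fun c' y => ev (tC c' c1) (tB b0 y))).symm
      refine Finset.sum_congr rfl fun y _ => Finset.sum_congr rfl fun z _ =>
        Finset.sum_congr rfl fun c _ => Finset.sum_congr rfl fun c' _ =>
        Finset.sum_congr rfl fun d' _ => ?_
      rw [hσcocycle (tA a0 a1) (tB y b1) (tG z g1) _ _ _ _ _ _ (hB.comul _ _) (hG.comul _ _) _ _ _
        (hA.comul _ _), hτcocycle (tC c0 c) (tD d0 d') (tF f0 f1) _ _ _ _ _ _ (hD.comul _ _)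
        (hF.comul _ _) _ _ _ (hC.comul _ _), hev.1 _ _ _ _ _ _ (hG.comul _ _)]
    intro x y z n m p x1 x2 y1 y2 z1 z2 hx hy hz
    rw [← cocL_apply mD st x y z y1 y2 z1 z2 hy hz, ← cocR_apply mD st x y z x1 x2 y1 y2 hx hy, h]
  · have h : st ∘ₗ (TensorProduct.mk k _ _).flip ((1 : B) ⊗ₜ[k] (1 : C)) = DrinCounit k B C := by
      refine ext_drin fun nA tA hA nC tC hC a0 a1 c0 c1 => ?_
      simp only [LinearMap.comp_apply, TensorProduct.mk_apply, LinearMap.flip_apply]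
      rw [drinCounit_comat hA hC, hst' _ _ _ _ (fun _ : Unit => (1 : B)) (fun _ => 1) _ _
        (by simp [Algebra.TensorProduct.one_def]) (hC.comul _ _)]
      simp [hσ1, hτ1, hev.2.2.2.1, hA.counit, hC.counit]
    exact fun x => LinearMap.congr_fun h x
  · have h : st ∘ₗ (TensorProduct.mk k _ _) ((1 : B) ⊗ₜ[k] (1 : C)) = DrinCounit k B C := by
      refine ext_drin fun nA tA hA nC tC hC a0 a1 c0 c1 => ?_
      simp only [LinearMap.comp_apply, TensorProduct.mk_apply]
      rw [drinCounit_comat hA hC, hst' _ _ _ _ _ _ (fun _ : Unit => (1 : C)) (fun _ => 1)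
        (hA.comul _ _) (by simp [Algebra.TensorProduct.one_def])]
      simp [hσ1', hτ1', hev.2.2.1, hA.counit, hC.counit]
    exact fun x => LinearMap.congr_fun h x

end
end

section
/- Let C and B be weakly dual Hopf algebras over a field k with pairing ev. (i) For every right 2-cocycle σ on B, the map Ind_Bσ defined by Ind_Bσ((b⊗c)⊗(b'⊗c')) := σ(b⊗b'₍₂₎) ev(c, b'₍₁₎) ε(c') is a right 2-cocycle on Drin_k(C,B). (ii) For every left 2-cocycle τ on C, the map Ind_Cτ defined by Ind_Cτ((b⊗c)⊗(b'⊗c')) := ε(b) τ(c₍₁₎⊗c') ev(c₍₂₎, b') is a right 2-cocycle on Drin_k(C,B). In both cases 'right 2-cocycle on Drin_k(C,B)' means convolution invertible, satisfying γ(x ⊗ y₍₁₎z₍₁₎)γ(y₍₂₎ ⊗ z₍₂₎) = γ(x₍₁₎y₍₁₎ ⊗ z)γ(x₍₂₎ ⊗ y₍₂₎) for all x,y,z ∈ Drin_k(C,B), and γ(x⊗1)=γ(1⊗x)=ε(x). -/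
/-!
STATEMENT 16: For weakly dual Hopf algebras `C`, `B`: (i) every right 2-cocycle `σ` on `B`
induces the right 2-cocycle `Ind_Bσ((b⊗c)⊗(b'⊗c')) = σ(b⊗b'₍₂₎) ev(c, b'₍₁₎) ε(c')` on
`Drin_k(C,B)`; (ii) every left 2-cocycle `τ` on `C` induces the right 2-cocycle
`Ind_Cτ((b⊗c)⊗(b'⊗c')) = ε(b) τ(c₍₁₎⊗c') ev(c₍₂₎, b')` on `Drin_k(C,B)`.
-/

open scoped TensorProduct

noncomputable section

variable {k B C : Type} [Field k] [Ring B] [HopfAlgebra k B] [Ring C] [HopfAlgebra k C]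

set_option linter.unusedSectionVars false
set_option linter.unusedSimpArgs false
namespace DrinAux
open Coalgebra WithConv

section conv
variable {k : Type} [Field k]
variable {M N P Q : Type} [AddCommGroup M] [Module k M] [Coalgebra k M]
  [AddCommGroup N] [Module k N] [Coalgebra k N] [AddCommGroup P] [Module k P] [Coalgebra k P]
  [AddCommGroup Q] [Module k Q] [Coalgebra k Q]

/-- every element of a tensor square is a finite sum of pure tensors indexed by `Fin n` -/
lemma exists_rep (t : M ⊗[k] N) :
    ∃ (n : ℕ) (a : Fin n → M) (b : Fin n → N), t = ∑ i, a i ⊗ₜ[k] b i := by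
  obtain ⟨s, hs⟩ := TensorProduct.exists_finset t
  refine ⟨s.card, fun i => (s.equivFin.symm i).1.1, fun i => (s.equivFin.symm i).1.2, ?_⟩
  rw [hs, ← Finset.sum_coe_sort s]
  exact (Equiv.sum_comp s.equivFin.symm (fun i : s => i.1.1 ⊗ₜ[k] i.1.2)).symm

/-- pullback of functionals along a coalgebra morphism -/
def pull (h : M →ₗc[k] N) (f : WithConv (N →ₗ[k] k)) : WithConv (M →ₗ[k] k) :=
  toConv (f.ofConv ∘ₗ h.toLinearMap)

@[simp] lemma pull_apply (h : M →ₗc[k] N) (f : WithConv (N →ₗ[k] k)) (x : M) :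
    pull h f x = f (h x) := rfl

lemma pull_mul (h : M →ₗc[k] N) (f g : WithConv (N →ₗ[k] k)) :
    pull h (f * g) = pull h f * pull h g := by
  unfold pull
  rw [LinearMap.convMul_comp_coalgHom_distrib]

lemma pull_one (h : M →ₗc[k] N) : pull h (1 : WithConv (N →ₗ[k] k)) = 1 := by
  ext x
  simp [pull, LinearMap.convOne_def]

lemma pull_pull (h : M →ₗc[k] N) (g : N →ₗc[k] P) (f : WithConv (P →ₗ[k] k)) :
    pull h (pull g f) = pull (g.comp h) f := rfl

lemma conv_apply {ι : Type} [Fintype ι] (f g : WithConv (M →ₗ[k] k)) (x : M)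
    (a b : ι → M) (h : comul (R := k) x = ∑ i, a i ⊗ₜ[k] b i) :
    (f * g) x = ∑ i, f (a i) * g (b i) := by
  rw [LinearMap.convMul_apply, h]; simp

lemma comul_tmul_rep {ι κ : Type} [Fintype ι] [Fintype κ] (x : M) (y : N)
    (a b : ι → M) (c d : κ → N) (h : comul (R := k) x = ∑ i, a i ⊗ₜ[k] b i)
    (h' : comul (R := k) y = ∑ i, c i ⊗ₜ[k] d i) :
    comul (R := k) (x ⊗ₜ[k] y) =
      ∑ p : ι × κ, (a p.1 ⊗ₜ[k] c p.2) ⊗ₜ[k] (b p.1 ⊗ₜ[k] d p.2) := by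
  rw [TensorProduct.comul_tmul, h, h', Fintype.sum_prod_type]
  simp only [TensorProduct.sum_tmul, TensorProduct.tmul_sum, map_sum]
  rw [Finset.sum_comm]
  rfl

lemma conv_tmul {ι κ : Type} [Fintype ι] [Fintype κ] (f g : WithConv (M ⊗[k] N →ₗ[k] k))
    (x : M) (y : N)
    (a b : ι → M) (c d : κ → N) (h : comul (R := k) x = ∑ i, a i ⊗ₜ[k] b i)
    (h' : comul (R := k) y = ∑ i, c i ⊗ₜ[k] d i) :
    (f * g) (x ⊗ₜ[k] y) = ∑ i, ∑ j, f (a i ⊗ₜ c j) * g (b i ⊗ₜ d j) := by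
  rw [conv_apply f g _ _ _ (comul_tmul_rep x y a b c d h h'), Fintype.sum_prod_type]

/-- projections -/
def p2 (k M N : Type) [Field k] [AddCommGroup M] [Module k M] [Coalgebra k M]
    [AddCommGroup N] [Module k N] [Coalgebra k N] : M ⊗[k] N →ₗc[k] N :=
  (Coalgebra.TensorProduct.lid k N).toCoalgHom.comp
    (Coalgebra.TensorProduct.map (counitCoalgHom k M) (CoalgHom.id k N))

def p1 (k M N : Type) [Field k] [AddCommGroup M] [Module k M] [Coalgebra k M]
    [AddCommGroup N] [Module k N] [Coalgebra k N] : M ⊗[k] N →ₗc[k] M :=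
  (Coalgebra.TensorProduct.rid k k M).toCoalgHom.comp
    (Coalgebra.TensorProduct.map (CoalgHom.id k M) (counitCoalgHom k N))

@[simp] lemma p2_tmul (x : M) (y : N) : p2 k M N (x ⊗ₜ y) = counit (R := k) x • y := rfl
@[simp] lemma p1_tmul (x : M) (y : N) : p1 k M N (x ⊗ₜ y) = counit (R := k) y • x := rfl

/-- partial evaluations -/
def sl (x : M) (G : WithConv (M ⊗[k] N →ₗ[k] k)) : WithConv (N →ₗ[k] k) :=
  toConv (TensorProduct.curry G.ofConv x)
def sr (y : N) (G : WithConv (M ⊗[k] N →ₗ[k] k)) : WithConv (M →ₗ[k] k) :=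
  toConv ((TensorProduct.curry G.ofConv).flip y)

@[simp] lemma sl_apply (x : M) (y : N) (G : WithConv (M ⊗[k] N →ₗ[k] k)) :
    sl x G y = G (x ⊗ₜ y) := rfl
@[simp] lemma sr_apply (x : M) (y : N) (G : WithConv (M ⊗[k] N →ₗ[k] k)) :
    sr y G x = G (x ⊗ₜ y) := rfl

lemma collapse_left {ι : Type} [Fintype ι] (x : M) (a b : ι → M)
    (h : comul (R := k) x = ∑ i, a i ⊗ₜ[k] b i) :
    ∑ i, counit (R := k) (a i) • b i = x := by
  have := congrArg (TensorProduct.lid k M) (rTensor_counit_comul (R := k) x)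
  rw [h] at this
  simpa using this

lemma collapse_right {ι : Type} [Fintype ι] (x : M) (a b : ι → M)
    (h : comul (R := k) x = ∑ i, a i ⊗ₜ[k] b i) :
    ∑ i, counit (R := k) (b i) • a i = x := by
  have := congrArg (TensorProduct.rid k M) (lTensor_counit_comul (R := k) x)
  rw [h] at this
  simpa using this

lemma ext_tmul (F G : WithConv (M ⊗[k] N →ₗ[k] k)) (h : ∀ x y, F (x ⊗ₜ y) = G (x ⊗ₜ y)) :
    F = G := by
  ext x y
  exact h x y

lemma sl_mul_left (x : M) (f : WithConv (N →ₗ[k] k)) (G : WithConv (M ⊗[k] N →ₗ[k] k)) :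
    sl x (pull (p2 k M N) f * G) = f * sl x G := by
  ext y
  obtain ⟨n, a, b, h⟩ := exists_rep (comul (R := k) x)
  obtain ⟨m, c, d, h'⟩ := exists_rep (comul (R := k) y)
  show sl x (pull (p2 k M N) f * G) y = _
  rw [sl_apply, conv_tmul _ _ x y a b c d h h', conv_apply _ _ y c d h']
  conv_rhs => rw [← collapse_left x a b h]
  rw [Finset.sum_comm]
  simp [TensorProduct.sum_tmul, Finset.mul_sum, ← TensorProduct.smul_tmul', mul_left_comm, mul_assoc]

lemma sl_mul_right (x : M) (f : WithConv (N →ₗ[k] k)) (G : WithConv (M ⊗[k] N →ₗ[k] k)) :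
    sl x (G * pull (p2 k M N) f) = sl x G * f := by
  ext y
  obtain ⟨n, a, b, h⟩ := exists_rep (comul (R := k) x)
  obtain ⟨m, c, d, h'⟩ := exists_rep (comul (R := k) y)
  show sl x (G * pull (p2 k M N) f) y = _
  rw [sl_apply, conv_tmul _ _ x y a b c d h h', conv_apply _ _ y c d h']
  conv_rhs => rw [← collapse_right x a b h]
  rw [Finset.sum_comm]
  simp [TensorProduct.sum_tmul, Finset.sum_mul, ← TensorProduct.smul_tmul', mul_left_comm, mul_assoc]

lemma sr_mul_left (y : N) (f : WithConv (M →ₗ[k] k)) (G : WithConv (M ⊗[k] N →ₗ[k] k)) :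
    sr y (pull (p1 k M N) f * G) = f * sr y G := by
  ext x
  obtain ⟨n, a, b, h⟩ := exists_rep (comul (R := k) x)
  obtain ⟨m, c, d, h'⟩ := exists_rep (comul (R := k) y)
  show sr y (pull (p1 k M N) f * G) x = _
  rw [sr_apply, conv_tmul _ _ x y a b c d h h', conv_apply _ _ x a b h]
  conv_rhs => rw [← collapse_left y c d h']
  simp [TensorProduct.tmul_sum, Finset.mul_sum, mul_left_comm, mul_assoc]

lemma sr_mul_right (y : N) (f : WithConv (M →ₗ[k] k)) (G : WithConv (M ⊗[k] N →ₗ[k] k)) :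
    sr y (G * pull (p1 k M N) f) = sr y G * f := by
  ext x
  obtain ⟨n, a, b, h⟩ := exists_rep (comul (R := k) x)
  obtain ⟨m, c, d, h'⟩ := exists_rep (comul (R := k) y)
  show sr y (G * pull (p1 k M N) f) x = _
  rw [sr_apply, conv_tmul _ _ x y a b c d h h', conv_apply _ _ x a b h]
  conv_rhs => rw [← collapse_right y c d h']
  simp [TensorProduct.tmul_sum, Finset.sum_mul, mul_left_comm, mul_assoc]

end conv

section cocyc
variable {k : Type} [Field k] {D : Type} [Ring D] [Bialgebra k D]
  {H : Type} [Ring H] [Bialgebra k H]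

variable (k D) in
/-- `x ⊗ (y ⊗ z) ↦ x ⊗ yz` -/
def mR : D ⊗[k] (D ⊗[k] D) →ₗc[k] D ⊗[k] D :=
  Coalgebra.TensorProduct.map (CoalgHom.id k D) (Bialgebra.mulCoalgHom k D)

variable (k D) in
/-- `x ⊗ (y ⊗ z) ↦ xy ⊗ z` -/
def mL : D ⊗[k] (D ⊗[k] D) →ₗc[k] D ⊗[k] D :=
  (Coalgebra.TensorProduct.map (Bialgebra.mulCoalgHom k D) (CoalgHom.id k D)).comp
    (Coalgebra.TensorProduct.assoc k k D D D).symm.toCoalgHom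

variable (k D) in
def q12 : D ⊗[k] (D ⊗[k] D) →ₗc[k] D ⊗[k] D :=
  (p1 k (D ⊗[k] D) D).comp (Coalgebra.TensorProduct.assoc k k D D D).symm.toCoalgHom

variable (k D) in
def q23 : D ⊗[k] (D ⊗[k] D) →ₗc[k] D ⊗[k] D := p2 k D (D ⊗[k] D)

@[simp] lemma mR_tmul (x y z : D) : mR k D (x ⊗ₜ (y ⊗ₜ z)) = x ⊗ₜ (y * z) := rfl
@[simp] lemma mL_tmul (x y z : D) : mL k D (x ⊗ₜ (y ⊗ₜ z)) = (x * y) ⊗ₜ z := rfl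
@[simp] lemma q12_tmul (x y z : D) :
  q12 k D (x ⊗ₜ (y ⊗ₜ z)) = counit (R := k) z • (x ⊗ₜ[k] y) := rfl
@[simp] lemma q23_tmul (x y z : D) :
  q23 k D (x ⊗ₜ (y ⊗ₜ z)) = counit (R := k) x • (y ⊗ₜ[k] z) := rfl

def RightCoc (φ : WithConv (D ⊗[k] D →ₗ[k] k)) : Prop :=
  pull (mR k D) φ * pull (q23 k D) φ = pull (mL k D) φ * pull (q12 k D) φ

def LeftCoc (φ : WithConv (D ⊗[k] D →ₗ[k] k)) : Prop :=
  pull (q23 k D) φ * pull (mR k D) φ = pull (q12 k D) φ * pull (mL k D) φ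

variable (k D) in
def as : (D ⊗[k] D) ⊗[k] D →ₗc[k] D ⊗[k] (D ⊗[k] D) :=
  (Coalgebra.TensorProduct.assoc k k D D D).toCoalgHom
@[simp] lemma as_tmul (x y z : D) : as k D ((x ⊗ₜ y) ⊗ₜ z) = x ⊗ₜ[k] (y ⊗ₜ[k] z) := rfl

lemma as_q12 (f : WithConv (D ⊗[k] D →ₗ[k] k)) :
    pull (as k D) (pull (q12 k D) f) = pull (p1 k (D ⊗[k] D) D) f := by
  ext x y z
  rfl

lemma apply_right23 (x y z : D) (G : WithConv (D ⊗[k] (D ⊗[k] D) →ₗ[k] k))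
    (f : WithConv (D ⊗[k] D →ₗ[k] k)) :
    (G * pull (q23 k D) f) (x ⊗ₜ (y ⊗ₜ z)) = (sl x G * f) (y ⊗ₜ z) := by
  rw [← sl_mul_right]; rfl
lemma apply_left23 (x y z : D) (G : WithConv (D ⊗[k] (D ⊗[k] D) →ₗ[k] k))
    (f : WithConv (D ⊗[k] D →ₗ[k] k)) :
    (pull (q23 k D) f * G) (x ⊗ₜ (y ⊗ₜ z)) = (f * sl x G) (y ⊗ₜ z) := by
  rw [← sl_mul_left]; rfl
lemma apply_right12 (x y z : D) (G : WithConv (D ⊗[k] (D ⊗[k] D) →ₗ[k] k))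
    (f : WithConv (D ⊗[k] D →ₗ[k] k)) :
    (G * pull (q12 k D) f) (x ⊗ₜ (y ⊗ₜ z)) = (sr z (pull (as k D) G) * f) (x ⊗ₜ y) := by
  rw [← sr_mul_right, ← as_q12, ← pull_mul]; rfl
lemma apply_left12 (x y z : D) (G : WithConv (D ⊗[k] (D ⊗[k] D) →ₗ[k] k))
    (f : WithConv (D ⊗[k] D →ₗ[k] k)) :
    (pull (q12 k D) f * G) (x ⊗ₜ (y ⊗ₜ z)) = (f * sr z (pull (as k D) G)) (x ⊗ₜ y) := by
  rw [← sr_mul_left, ← as_q12, ← pull_mul]; rfl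

/-- pulling back right cocycles along bialgebra maps -/
lemma RightCoc.pull {φ : WithConv (H ⊗[k] H →ₗ[k] k)} (hφ : RightCoc φ) (p : D →ₐc[k] H) :
    RightCoc (pull (Coalgebra.TensorProduct.map (p : D →ₗc[k] H) (p : D →ₗc[k] H)) φ) := by
  have := congrArg (DrinAux.pull (Coalgebra.TensorProduct.map (p : D →ₗc[k] H)
    (Coalgebra.TensorProduct.map (p : D →ₗc[k] H) (p : D →ₗc[k] H)))) hφ
  unfold RightCoc
  rw [pull_mul, pull_mul] at this
  convert this using 2 <;> · ext x y z; simp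

end cocyc

section main
variable {k : Type} [Field k] {D : Type} [Ring D] [Bialgebra k D]

lemma twist_coc (R Rinv φ γ : WithConv (D ⊗[k] D →ₗ[k] k)) (h2 : Rinv * R = 1)
    (hR : LeftCoc R) (hφ : RightCoc φ) (hγ : γ = R * φ) (mD : D ⊗[k] D →ₗ[k] D)
    (hm : ∀ f : WithConv (D →ₗ[k] k), toConv (f.ofConv ∘ₗ mD)
      = R * pull (Bialgebra.mulCoalgHom k D) f * Rinv) :
    toConv (γ.ofConv ∘ₗ TensorProduct.map LinearMap.id mD) * pull (q23 k D) γ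
      = toConv (γ.ofConv ∘ₗ TensorProduct.map mD LinearMap.id
          ∘ₗ (TensorProduct.assoc k D D D).symm.toLinearMap) * pull (q12 k D) γ := by
  have e1 : toConv (γ.ofConv ∘ₗ TensorProduct.map LinearMap.id mD) =
      pull (q23 k D) R * pull (mR k D) γ * pull (q23 k D) Rinv := by
    ext x y z
    have := congrArg (fun F => F (y ⊗ₜ z)) (congrArg ofConv (hm (sl x γ)))
    refine this.trans ?_
    refine Eq.trans ?_ (apply_right23 x y z _ _).symm
    rw [show sl x (pull (q23 k D) R * pull (mR k D) γ) = _ from sl_mul_left ..]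
    rfl
  have e2 : toConv (γ.ofConv ∘ₗ TensorProduct.map mD LinearMap.id
          ∘ₗ (TensorProduct.assoc k D D D).symm.toLinearMap) =
      pull (q12 k D) R * pull (mL k D) γ * pull (q12 k D) Rinv := by
    ext x y z
    have := congrArg (fun F => F (x ⊗ₜ y)) (congrArg ofConv (hm (sr z γ)))
    refine this.trans ?_
    refine Eq.trans ?_ (apply_right12 x y z _ _).symm
    have h3 : sr z (pull (as k D) (pull (mL k D) γ)) =
        pull (Bialgebra.mulCoalgHom k D) (sr z γ) := ext_tmul _ _ fun _ _ => rfl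
    rw [pull_mul, as_q12, sr_mul_left, h3]
  have h23 : pull (q23 k D) Rinv * pull (q23 k D) R = 1 := by rw [← pull_mul, h2, pull_one]
  have h12 : pull (q12 k D) Rinv * pull (q12 k D) R = 1 := by rw [← pull_mul, h2, pull_one]
  unfold LeftCoc at hR
  unfold RightCoc at hφ
  rw [e1, e2, hγ]
  simp only [pull_mul]
  calc _ = (pull (q23 k D) R * pull (mR k D) R) * pull (mR k D) φ *
        (pull (q23 k D) Rinv * pull (q23 k D) R) * pull (q23 k D) φ := by simp only [mul_assoc]
    _ = (pull (q12 k D) R * pull (mL k D) R) * (pull (mR k D) φ * pull (q23 k D) φ) := by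
        rw [h23, hR]; simp only [mul_assoc, one_mul]
    _ = (pull (q12 k D) R * pull (mL k D) R) * pull (mL k D) φ *
        (pull (q12 k D) Rinv * pull (q12 k D) R) * pull (q12 k D) φ := by
        rw [h12, hφ]; simp only [mul_assoc, one_mul]
    _ = _ := by simp only [mul_assoc]


/-- Elementwise right 2-cocycle condition relative to a product `mD`. -/
def AbsCoc (mD : D ⊗[k] D →ₗ[k] D) (γ : D ⊗[k] D →ₗ[k] k) : Prop :=
  (∃ γinv : D ⊗[k] D →ₗ[k] k,
    ∀ (x y : D) (n m : ℕ) (x1 x2 : Fin n → D) (y1 y2 : Fin m → D),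
      comul (R := k) x = ∑ i, x1 i ⊗ₜ[k] x2 i →
      comul (R := k) y = ∑ j, y1 j ⊗ₜ[k] y2 j →
      (∑ i, ∑ j, γ (x1 i ⊗ₜ[k] y1 j) * γinv (x2 i ⊗ₜ[k] y2 j)
          = counit (R := k) x * counit (R := k) y) ∧
      (∑ i, ∑ j, γinv (x1 i ⊗ₜ[k] y1 j) * γ (x2 i ⊗ₜ[k] y2 j)
          = counit (R := k) x * counit (R := k) y)) ∧
  (∀ (x y z : D) (n m p : ℕ)
      (x1 x2 : Fin n → D) (y1 y2 : Fin m → D) (z1 z2 : Fin p → D),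
    comul (R := k) x = ∑ i, x1 i ⊗ₜ[k] x2 i →
    comul (R := k) y = ∑ j, y1 j ⊗ₜ[k] y2 j →
    comul (R := k) z = ∑ s, z1 s ⊗ₜ[k] z2 s →
    ∑ j, ∑ s, γ (x ⊗ₜ[k] mD (y1 j ⊗ₜ[k] z1 s)) * γ (y2 j ⊗ₜ[k] z2 s)
      = ∑ i, ∑ j, γ (mD (x1 i ⊗ₜ[k] y1 j) ⊗ₜ[k] z) * γ (x2 i ⊗ₜ[k] y2 j)) ∧
  (∀ x : D, γ (x ⊗ₜ[k] 1) = counit (R := k) x) ∧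
  (∀ x : D, γ (1 ⊗ₜ[k] x) = counit (R := k) x)

lemma comul_one_rep : comul (R := k) (1 : D) = ∑ _i : Fin 1, (1 : D) ⊗ₜ[k] (1 : D) := by
  simp [Algebra.TensorProduct.one_def]

lemma one_tmul_apply (x y : D) : (1 : WithConv (D ⊗[k] D →ₗ[k] k)) (x ⊗ₜ y) =
    counit (R := k) x * counit (R := k) y := by
  simp [mul_comm]

lemma unit_right (f g : WithConv (D ⊗[k] D →ₗ[k] k))
    (hf : ∀ x, f (x ⊗ₜ 1) = counit (R := k) x) (hg : ∀ x, g (x ⊗ₜ 1) = counit (R := k) x) (x : D) :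
    (f * g) (x ⊗ₜ 1) = counit (R := k) x := by
  obtain ⟨n, a, b, h⟩ := exists_rep (comul (R := k) x)
  rw [conv_tmul f g x 1 a b _ _ h comul_one_rep]
  conv_rhs => rw [← collapse_left x a b h]
  simp [hf, hg]

lemma unit_left (f g : WithConv (D ⊗[k] D →ₗ[k] k))
    (hf : ∀ x, f (1 ⊗ₜ x) = counit (R := k) x) (hg : ∀ x, g (1 ⊗ₜ x) = counit (R := k) x) (x : D) :
    (f * g) (1 ⊗ₜ x) = counit (R := k) x := by
  obtain ⟨n, a, b, h⟩ := exists_rep (comul (R := k) x)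
  rw [conv_tmul f g 1 x _ _ a b comul_one_rep h]
  conv_rhs => rw [← collapse_left x a b h]
  simp [hf, hg]

lemma absCoc_of_twist (R Rinv φ φinv γ : WithConv (D ⊗[k] D →ₗ[k] k))
    (h1 : R * Rinv = 1) (h2 : Rinv * R = 1) (h3 : φ * φinv = 1) (h4 : φinv * φ = 1)
    (hR : LeftCoc R) (hφ : RightCoc φ) (hγ : γ = R * φ) (mD : D ⊗[k] D →ₗ[k] D)
    (hm : ∀ f : WithConv (D →ₗ[k] k), toConv (f.ofConv ∘ₗ mD)
      = R * pull (Bialgebra.mulCoalgHom k D) f * Rinv)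
    (hR1 : ∀ x, R (x ⊗ₜ 1) = counit (R := k) x) (hR2 : ∀ x, R (1 ⊗ₜ x) = counit (R := k) x)
    (hφ1 : ∀ x, φ (x ⊗ₜ 1) = counit (R := k) x) (hφ2 : ∀ x, φ (1 ⊗ₜ x) = counit (R := k) x) :
    AbsCoc mD γ.ofConv := by
  refine ⟨⟨(φinv * Rinv).ofConv, ?_⟩, ?_, ?_, ?_⟩
  · intro x y n m x1 x2 y1 y2 hx hy
    rw [← conv_tmul γ (φinv * Rinv) x y x1 x2 y1 y2 hx hy,
      ← conv_tmul (φinv * Rinv) γ x y x1 x2 y1 y2 hx hy]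
    have e1 : γ * (φinv * Rinv) = 1 := by
      rw [hγ, mul_assoc, ← mul_assoc φ, h3, one_mul, h1]
    have e2 : (φinv * Rinv) * γ = 1 := by
      rw [hγ, mul_assoc, ← mul_assoc Rinv, h2, one_mul, h4]
    rw [e1, e2]
    exact ⟨one_tmul_apply x y, one_tmul_apply x y⟩
  · intro x y z n m p x1 x2 y1 y2 z1 z2 hx hy hz
    have := congrArg (fun F => F (x ⊗ₜ (y ⊗ₜ z)))
      (congrArg ofConv (twist_coc R Rinv φ γ h2 hR hφ hγ mD hm))
    beta_reduce at this
    rw [apply_right23, apply_right12, conv_tmul _ _ y z _ _ _ _ hy hz,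
      conv_tmul _ _ x y _ _ _ _ hx hy] at this
    exact this
  · rw [hγ]; exact unit_right R φ hR1 hφ1
  · rw [hγ]; exact unit_left R φ hR2 hφ2

end main

section double
variable {k B E : Type} [Field k] [Ring B] [HopfAlgebra k B] [Ring E] [Bialgebra k E]

variable (k B E) in
def πB : B ⊗[k] E →ₐc[k] B :=
  (Bialgebra.TensorProduct.rid k k B : B ⊗[k] k →ₐc[k] B).comp
    (Bialgebra.TensorProduct.map (BialgHom.id k B) (Bialgebra.counitBialgHom k E))

variable (k B E) in
def πE : B ⊗[k] E →ₐc[k] E :=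
  (Bialgebra.TensorProduct.lid k E : k ⊗[k] E →ₐc[k] E).comp
    (Bialgebra.TensorProduct.map (Bialgebra.counitBialgHom k B) (BialgHom.id k E))

@[simp] lemma πB_tmul (b : B) (c : E) : πB k B E (b ⊗ₜ c) = counit (R := k) c • b := rfl
@[simp] lemma πE_tmul (b : B) (c : E) : πE k B E (b ⊗ₜ c) = counit (R := k) b • c := rfl

variable (k B E) in
def πEB : (B ⊗[k] E) ⊗[k] (B ⊗[k] E) →ₗc[k] E ⊗[k] B :=
  Coalgebra.TensorProduct.map (πE k B E : B ⊗[k] E →ₗc[k] E) (πB k B E : B ⊗[k] E →ₗc[k] B)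
variable (k B E) in
def πBB : (B ⊗[k] E) ⊗[k] (B ⊗[k] E) →ₗc[k] B ⊗[k] B :=
  Coalgebra.TensorProduct.map (πB k B E : B ⊗[k] E →ₗc[k] B) (πB k B E : B ⊗[k] E →ₗc[k] B)
variable (k B E) in
def πEE : (B ⊗[k] E) ⊗[k] (B ⊗[k] E) →ₗc[k] E ⊗[k] E :=
  Coalgebra.TensorProduct.map (πE k B E : B ⊗[k] E →ₗc[k] E) (πE k B E : B ⊗[k] E →ₗc[k] E)

@[simp] lemma πEB_tmul (x y : B ⊗[k] E) : πEB k B E (x ⊗ₜ y) = πE k B E x ⊗ₜ πB k B E y := rfl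
@[simp] lemma πBB_tmul (x y : B ⊗[k] E) : πBB k B E (x ⊗ₜ y) = πB k B E x ⊗ₜ πB k B E y := rfl
@[simp] lemma πEE_tmul (x y : B ⊗[k] E) : πEE k B E (x ⊗ₜ y) = πE k B E x ⊗ₜ πE k B E y := rfl

lemma R_mul_apply {n m : ℕ} (e : WithConv (E ⊗[k] B →ₗ[k] k))
    (G : WithConv ((B ⊗[k] E) ⊗[k] (B ⊗[k] E) →ₗ[k] k)) (b b' : B) (c c' : E)
    (c1 c2 : Fin n → E) (b1 b2 : Fin m → B) (hc : comul (R := k) c = ∑ i, c1 i ⊗ₜ[k] c2 i)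
    (hb : comul (R := k) b' = ∑ i, b1 i ⊗ₜ[k] b2 i) :
    (pull (πEB k B E) e * G) ((b ⊗ₜ c) ⊗ₜ (b' ⊗ₜ c')) =
      ∑ i, ∑ j, e (c1 i ⊗ₜ b1 j) * G ((b ⊗ₜ c2 i) ⊗ₜ (b2 j ⊗ₜ c')) := by
  obtain ⟨p, u, v, h⟩ := exists_rep (comul (R := k) b)
  obtain ⟨q, s, t, h'⟩ := exists_rep (comul (R := k) c')
  rw [conv_tmul _ _ _ _ _ _ _ _ (comul_tmul_rep b c u v c1 c2 h hc)
    (comul_tmul_rep b' c' b1 b2 s t hb h')]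
  conv_rhs => rw [← collapse_left b u v h, ← collapse_left c' s t h']
  simp only [Fintype.sum_prod_type]
  rw [Finset.sum_comm]
  refine Finset.sum_congr rfl fun i _ => ?_
  rw [Finset.sum_comm]
  refine Finset.sum_congr rfl fun j _ => ?_
  simp only [TensorProduct.sum_tmul, TensorProduct.tmul_sum, map_sum, Finset.mul_sum]
  rw [Finset.sum_comm]
  refine Finset.sum_congr rfl fun _ _ => Finset.sum_congr rfl fun _ _ => ?_
  simp [← TensorProduct.smul_tmul']
  ring

lemma mul_R_apply {n m : ℕ} (e : WithConv (E ⊗[k] B →ₗ[k] k))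
    (G : WithConv ((B ⊗[k] E) ⊗[k] (B ⊗[k] E) →ₗ[k] k)) (b b' : B) (c c' : E)
    (c1 c2 : Fin n → E) (b1 b2 : Fin m → B) (hc : comul (R := k) c = ∑ i, c1 i ⊗ₜ[k] c2 i)
    (hb : comul (R := k) b' = ∑ i, b1 i ⊗ₜ[k] b2 i) :
    (G * pull (πEB k B E) e) ((b ⊗ₜ c) ⊗ₜ (b' ⊗ₜ c')) =
      ∑ i, ∑ j, G ((b ⊗ₜ c1 i) ⊗ₜ (b1 j ⊗ₜ c')) * e (c2 i ⊗ₜ b2 j) := by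
  obtain ⟨p, u, v, h⟩ := exists_rep (comul (R := k) b)
  obtain ⟨q, s, t, h'⟩ := exists_rep (comul (R := k) c')
  rw [conv_tmul _ _ _ _ _ _ _ _ (comul_tmul_rep b c u v c1 c2 h hc)
    (comul_tmul_rep b' c' b1 b2 s t hb h')]
  conv_rhs => rw [← collapse_right b u v h, ← collapse_right c' s t h']
  simp only [Fintype.sum_prod_type]
  rw [Finset.sum_comm]
  refine Finset.sum_congr rfl fun i _ => ?_
  rw [Finset.sum_comm]
  refine Finset.sum_congr rfl fun j _ => ?_
  simp only [TensorProduct.sum_tmul, TensorProduct.tmul_sum, map_sum, Finset.sum_mul]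
  rw [Finset.sum_comm]
  refine Finset.sum_congr rfl fun _ _ => Finset.sum_congr rfl fun _ _ => ?_
  simp [← TensorProduct.smul_tmul']
  ring

lemma leftCoc_R (ev : E →ₗ[k] B →ₗ[k] k)
    (hev1 : ∀ (c c' : E) (b : B) (n : ℕ) (b1 b2 : Fin n → B),
      comul (R := k) b = ∑ i, b1 i ⊗ₜ[k] b2 i →
      ev (c * c') b = ∑ i, ev c (b2 i) * ev c' (b1 i))
    (hev2 : ∀ (c : E) (b b' : B) (m : ℕ) (c1 c2 : Fin m → E),
      comul (R := k) c = ∑ j, c1 j ⊗ₜ[k] c2 j →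
      ev c (b * b') = ∑ j, ev (c1 j) b * ev (c2 j) b') :
    LeftCoc (pull (πEB k B E) (toConv (TensorProduct.lift ev))) := by
  unfold LeftCoc
  ext a c b d e f
  change (pull (q23 k (B ⊗[k] E)) (pull (πEB k B E) (toConv (TensorProduct.lift ev))) *
    pull (mR k (B ⊗[k] E)) _) ((a ⊗ₜ c) ⊗ₜ ((b ⊗ₜ d) ⊗ₜ (e ⊗ₜ f))) =
    (pull (q12 k (B ⊗[k] E)) (pull (πEB k B E) (toConv (TensorProduct.lift ev))) *
    pull (mL k (B ⊗[k] E)) _) ((a ⊗ₜ c) ⊗ₜ ((b ⊗ₜ d) ⊗ₜ (e ⊗ₜ f)))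
  obtain ⟨n1, c1, c2, hc⟩ := exists_rep (comul (R := k) c)
  obtain ⟨n2, d1, d2, hd⟩ := exists_rep (comul (R := k) d)
  obtain ⟨n3, b1, b2, hb⟩ := exists_rep (comul (R := k) b)
  obtain ⟨n4, e1, e2, he⟩ := exists_rep (comul (R := k) e)
  rw [apply_left23, apply_left12, R_mul_apply _ _ _ _ _ _ _ _ _ _ hd he,
    R_mul_apply _ _ _ _ _ _ _ _ _ _ hc hb]
  simp [hev1 _ _ e _ _ _ he, hev2 c _ _ _ _ _ hc]
  have hd' : ∀ y, ∑ x, counit (R := k) (d2 x) * ev (d1 x) y = ev d y := by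
    intro y
    conv_rhs => rw [← collapse_right d d1 d2 hd]
    simp
  have hb' : ∀ y, ∑ x, counit (R := k) (b2 x) * ev y (b1 x) = ev y b := by
    intro y
    conv_rhs => rw [← collapse_right b b1 b2 hb]
    simp
  calc _ = ∑ j, (∑ x, counit (R := k) (d2 x) * ev (d1 x) (e1 j)) *
        (counit f * (counit a * ∑ l, (ev (c1 l)) b * (ev (c2 l)) (e2 j))) := by
        rw [Finset.sum_comm]
        refine Finset.sum_congr rfl fun j _ => ?_
        rw [Finset.sum_mul]
        refine Finset.sum_congr rfl fun j _ => ?_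
        ring
    _ = ∑ l, (∑ x, counit (R := k) (b2 x) * ev (c1 l) (b1 x)) *
        (counit f * (counit a * ∑ j, (ev (c2 l)) (e2 j) * (ev d) (e1 j))) := by
        simp only [hd', hb', Finset.mul_sum]
        rw [Finset.sum_comm]
        refine Finset.sum_congr rfl fun j _ => Finset.sum_congr rfl fun l _ => ?_
        ring
    _ = _ := by
        refine Finset.sum_congr rfl fun j _ => ?_
        rw [Finset.sum_mul]
        refine Finset.sum_congr rfl fun j _ => ?_
        ring

section inv

lemma e_einv (ev : E →ₗ[k] B →ₗ[k] k)
    (hev2 : ∀ (c : E) (b b' : B) (m : ℕ) (c1 c2 : Fin m → E),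
      comul (R := k) c = ∑ j, c1 j ⊗ₜ[k] c2 j →
      ev c (b * b') = ∑ j, ev (c1 j) b * ev (c2 j) b')
    (hev4 : ∀ c : E, ev c 1 = counit (R := k) c)
    : toConv (TensorProduct.lift ev) *
    toConv (TensorProduct.lift (ev.compl₂ (HopfAlgebra.antipode k (A := B)))) = 1 := by
  refine ext_tmul _ _ fun c b => ?_
  obtain ⟨n1, c1, c2, hc⟩ := exists_rep (comul (R := k) c)
  obtain ⟨n3, b1, b2, hb⟩ := exists_rep (comul (R := k) b)
  rw [conv_tmul _ _ _ _ _ _ _ _ hc hb, Finset.sum_comm]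
  have := HopfAlgebra.mul_antipode_lTensor_comul_apply (R := k) b
  rw [hb] at this
  simp at this
  have h2 := congrArg (ev c) this
  simp [hev2 c _ _ _ _ _ hc, hev4, Algebra.algebraMap_eq_smul_one] at h2
  simpa using h2

lemma einv_e (ev : E →ₗ[k] B →ₗ[k] k)
    (hev2 : ∀ (c : E) (b b' : B) (m : ℕ) (c1 c2 : Fin m → E),
      comul (R := k) c = ∑ j, c1 j ⊗ₜ[k] c2 j →
      ev c (b * b') = ∑ j, ev (c1 j) b * ev (c2 j) b')
    (hev4 : ∀ c : E, ev c 1 = counit (R := k) c)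
    : toConv (TensorProduct.lift (ev.compl₂ (HopfAlgebra.antipode k (A := B)))) *
    toConv (TensorProduct.lift ev) = 1 := by
  refine ext_tmul _ _ fun c b => ?_
  obtain ⟨n1, c1, c2, hc⟩ := exists_rep (comul (R := k) c)
  obtain ⟨n3, b1, b2, hb⟩ := exists_rep (comul (R := k) b)
  rw [conv_tmul _ _ _ _ _ _ _ _ hc hb, Finset.sum_comm]
  have := HopfAlgebra.mul_antipode_rTensor_comul_apply (R := k) b
  rw [hb] at this
  simp at this
  have h2 := congrArg (ev c) this
  simp [hev2 c _ _ _ _ _ hc, hev4, Algebra.algebraMap_eq_smul_one] at h2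
  simpa using h2
end inv

lemma hm_of (e e' : WithConv (E ⊗[k] B →ₗ[k] k))
    (mD : (B ⊗[k] E) ⊗[k] (B ⊗[k] E) →ₗ[k] B ⊗[k] E)
    (hmD : ∀ (b : B) (c : E) (b' : B) (c' : E)
      (n : ℕ) (p1 p2 : Fin n → B) (q : Fin n → ℕ) (pp1 pp2 : (i : Fin n) → Fin (q i) → B)
      (m : ℕ) (r1 r2 : Fin m → E) (s : Fin m → ℕ) (rr1 rr2 : (j : Fin m) → Fin (s j) → E),
      comul (R := k) b' = ∑ i, p1 i ⊗ₜ[k] p2 i →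
      (∀ i, comul (R := k) (p2 i) = ∑ i', pp1 i i' ⊗ₜ[k] pp2 i i') →
      comul (R := k) c = ∑ j, r2 j ⊗ₜ[k] r1 j →
      (∀ j, comul (R := k) (r2 j) = ∑ j', rr2 j j' ⊗ₜ[k] rr1 j j') →
      mD ((b ⊗ₜ[k] c) ⊗ₜ[k] (b' ⊗ₜ[k] c'))
        = ∑ i, ∑ i', ∑ j, ∑ j',
            (e' (r1 j ⊗ₜ pp2 i i') * e (rr2 j j' ⊗ₜ p1 i))
              • ((b * pp1 i i') ⊗ₜ[k] (rr1 j j' * c')))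
    (f : WithConv (B ⊗[k] E →ₗ[k] k)) :
    toConv (f.ofConv ∘ₗ mD) = pull (πEB k B E) e *
      pull (Bialgebra.mulCoalgHom k (B ⊗[k] E)) f * pull (πEB k B E) e' := by
  ext b c b' c'
  change f (mD ((b ⊗ₜ[k] c) ⊗ₜ[k] (b' ⊗ₜ[k] c'))) = (pull (πEB k B E) e *
      pull (Bialgebra.mulCoalgHom k (B ⊗[k] E)) f * pull (πEB k B E) e')
      ((b ⊗ₜ[k] c) ⊗ₜ[k] (b' ⊗ₜ[k] c'))
  choose N u v huv using fun x : E => exists_rep (comul (R := k) x)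
  choose N' u' v' huv' using fun x : B => exists_rep (comul (R := k) x)
  rw [mul_assoc, R_mul_apply _ _ _ _ _ _ _ _ _ _ (huv c) (huv' b'), hmD b c b' c' _ _ _ _
    (fun i => u' (v' b' i)) (fun i => v' (v' b' i)) _ (v c) (u c) _ (fun j => v (u c j))
    (fun j => u (u c j)) (huv' b') (fun i => huv' _) (huv c) (fun j => huv _)]
  simp only [mul_R_apply _ _ _ _ _ _ _ _ _ _ (huv _) (huv' _), map_sum, map_smul]
  rw [Finset.sum_comm (s := Finset.univ (α := Fin (N c)))]
  refine Finset.sum_congr rfl fun i _ => ?_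
  simp only [Finset.mul_sum]
  conv_rhs =>
    enter [2, x]
    rw [Finset.sum_comm]
  rw [Finset.sum_comm (s := Finset.univ (α := Fin (N c)))]
  refine Finset.sum_congr rfl fun i' _ => ?_
  let A1 : WithConv (E →ₗ[k] k) := sr (u' b' i) e
  let A3 : WithConv (E →ₗ[k] k) := sr (v' (v' b' i) i') e'
  let A2 : WithConv (E →ₗ[k] k) := toConv (f.ofConv ∘ₗ TensorProduct.mk k B E (b * u' (v' b' i) i')
    ∘ₗ LinearMap.mulRight k c')
  have key := congrArg (fun F => F c) (congrArg ofConv (mul_assoc A1 A2 A3))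
  beta_reduce at key
  rw [conv_apply _ _ _ _ _ (huv c), conv_apply _ _ _ _ _ (huv c)] at key
  simp only [conv_apply _ _ _ _ _ (huv (_ : E)), Finset.sum_mul, Finset.mul_sum] at key
  refine Eq.trans ?_ (key.trans ?_)
  · refine Finset.sum_congr rfl fun j _ => Finset.sum_congr rfl fun j' _ => ?_
    simp [A1, A2, A3]
    ring
  · refine Finset.sum_congr rfl fun j _ => Finset.sum_congr rfl fun j' _ => ?_
    simp [A1, A2, A3]

section final

lemma counit_πB (x : B ⊗[k] E) : counit (R := k) (πB k B E x) = counit (R := k) x :=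
  CoalgHomClass.counit_comp_apply (πB k B E) x
lemma counit_πE (x : B ⊗[k] E) : counit (R := k) (πE k B E x) = counit (R := k) x :=
  CoalgHomClass.counit_comp_apply (πE k B E) x

lemma final_aux (ev : E →ₗ[k] B →ₗ[k] k)
    (hev1 : ∀ (c c' : E) (b : B) (n : ℕ) (b1 b2 : Fin n → B),
      comul (R := k) b = ∑ i, b1 i ⊗ₜ[k] b2 i →
      ev (c * c') b = ∑ i, ev c (b2 i) * ev c' (b1 i))
    (hev2 : ∀ (c : E) (b b' : B) (m : ℕ) (c1 c2 : Fin m → E),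
      comul (R := k) c = ∑ j, c1 j ⊗ₜ[k] c2 j →
      ev c (b * b') = ∑ j, ev (c1 j) b * ev (c2 j) b')
    (hev3 : ∀ b : B, ev 1 b = counit (R := k) b)
    (hev4 : ∀ c : E, ev c 1 = counit (R := k) c)
    (mD : (B ⊗[k] E) ⊗[k] (B ⊗[k] E) →ₗ[k] B ⊗[k] E)
    (hmD : ∀ (b : B) (c : E) (b' : B) (c' : E)
      (n : ℕ) (p1 p2 : Fin n → B) (q : Fin n → ℕ) (pp1 pp2 : (i : Fin n) → Fin (q i) → B)
      (m : ℕ) (r1 r2 : Fin m → E) (s : Fin m → ℕ) (rr1 rr2 : (j : Fin m) → Fin (s j) → E),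
      comul (R := k) b' = ∑ i, p1 i ⊗ₜ[k] p2 i →
      (∀ i, comul (R := k) (p2 i) = ∑ i', pp1 i i' ⊗ₜ[k] pp2 i i') →
      comul (R := k) c = ∑ j, r2 j ⊗ₜ[k] r1 j →
      (∀ j, comul (R := k) (r2 j) = ∑ j', rr2 j j' ⊗ₜ[k] rr1 j j') →
      mD ((b ⊗ₜ[k] c) ⊗ₜ[k] (b' ⊗ₜ[k] c'))
        = ∑ i, ∑ i', ∑ j, ∑ j',
            (ev (r1 j) (HopfAlgebra.antipode k (pp2 i i')) * ev (rr2 j j') (p1 i))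
              • ((b * pp1 i i') ⊗ₜ[k] (rr1 j j' * c')))
    (φ φinv γ : WithConv ((B ⊗[k] E) ⊗[k] (B ⊗[k] E) →ₗ[k] k))
    (h3 : φ * φinv = 1) (h4 : φinv * φ = 1) (hφ : RightCoc φ)
    (hγ : γ = pull (πEB k B E) (toConv (TensorProduct.lift ev)) * φ)
    (hφ1 : ∀ x, φ (x ⊗ₜ 1) = counit (R := k) x) (hφ2 : ∀ x, φ (1 ⊗ₜ x) = counit (R := k) x) :
    AbsCoc mD γ.ofConv := by
  refine absCoc_of_twist _ (pull (πEB k B E)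
    (toConv (TensorProduct.lift (ev.compl₂ (HopfAlgebra.antipode k (A := B)))))) φ φinv γ
    ?_ ?_ h3 h4 (leftCoc_R ev hev1 hev2) hφ hγ mD (hm_of _ _ mD ?_) ?_ ?_ hφ1 hφ2
  · rw [← pull_mul, e_einv ev hev2 hev4, pull_one]
  · rw [← pull_mul, einv_e ev hev2 hev4, pull_one]
  · exact hmD
  · intro x
    simp [hev4, counit_πE]
  · intro x
    simp [hev3, counit_πB]

theorem final_B (ev : E →ₗ[k] B →ₗ[k] k)
    (hev1 : ∀ (c c' : E) (b : B) (n : ℕ) (b1 b2 : Fin n → B),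
      comul (R := k) b = ∑ i, b1 i ⊗ₜ[k] b2 i →
      ev (c * c') b = ∑ i, ev c (b2 i) * ev c' (b1 i))
    (hev2 : ∀ (c : E) (b b' : B) (m : ℕ) (c1 c2 : Fin m → E),
      comul (R := k) c = ∑ j, c1 j ⊗ₜ[k] c2 j →
      ev c (b * b') = ∑ j, ev (c1 j) b * ev (c2 j) b')
    (hev3 : ∀ b : B, ev 1 b = counit (R := k) b)
    (hev4 : ∀ c : E, ev c 1 = counit (R := k) c)
    (mD : (B ⊗[k] E) ⊗[k] (B ⊗[k] E) →ₗ[k] B ⊗[k] E)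
    (hmD : ∀ (b : B) (c : E) (b' : B) (c' : E)
      (n : ℕ) (p1 p2 : Fin n → B) (q : Fin n → ℕ) (pp1 pp2 : (i : Fin n) → Fin (q i) → B)
      (m : ℕ) (r1 r2 : Fin m → E) (s : Fin m → ℕ) (rr1 rr2 : (j : Fin m) → Fin (s j) → E),
      comul (R := k) b' = ∑ i, p1 i ⊗ₜ[k] p2 i →
      (∀ i, comul (R := k) (p2 i) = ∑ i', pp1 i i' ⊗ₜ[k] pp2 i i') →
      comul (R := k) c = ∑ j, r2 j ⊗ₜ[k] r1 j →
      (∀ j, comul (R := k) (r2 j) = ∑ j', rr2 j j' ⊗ₜ[k] rr1 j j') →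
      mD ((b ⊗ₜ[k] c) ⊗ₜ[k] (b' ⊗ₜ[k] c'))
        = ∑ i, ∑ i', ∑ j, ∑ j',
            (ev (r1 j) (HopfAlgebra.antipode k (pp2 i i')) * ev (rr2 j j') (p1 i))
              • ((b * pp1 i i') ⊗ₜ[k] (rr1 j j' * c')))
    (σ σinv : B ⊗[k] B →ₗ[k] k)
    (hσconv : ∀ (a b : B) (n m : ℕ) (a1 a2 : Fin n → B) (b1 b2 : Fin m → B),
      Coalgebra.comul (R := k) a = ∑ i, a1 i ⊗ₜ[k] a2 i →
      Coalgebra.comul (R := k) b = ∑ j, b1 j ⊗ₜ[k] b2 j →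
      (∑ i, ∑ j, σ (a1 i ⊗ₜ[k] b1 j) * σinv (a2 i ⊗ₜ[k] b2 j)
          = Coalgebra.counit (R := k) a * Coalgebra.counit (R := k) b) ∧
      (∑ i, ∑ j, σinv (a1 i ⊗ₜ[k] b1 j) * σ (a2 i ⊗ₜ[k] b2 j)
          = Coalgebra.counit (R := k) a * Coalgebra.counit (R := k) b))
    (hσcocycle : ∀ (h g l : B) (m p : ℕ) (g1 g2 : Fin m → B) (l1 l2 : Fin p → B),
      Coalgebra.comul (R := k) g = ∑ j, g1 j ⊗ₜ[k] g2 j →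
      Coalgebra.comul (R := k) l = ∑ s, l1 s ⊗ₜ[k] l2 s →
      ∀ (n : ℕ) (h1 h2 : Fin n → B),
      Coalgebra.comul (R := k) h = ∑ i, h1 i ⊗ₜ[k] h2 i →
      ∑ j, ∑ s, σ (h ⊗ₜ[k] (g1 j * l1 s)) * σ (g2 j ⊗ₜ[k] l2 s)
        = ∑ i, ∑ j, σ ((h1 i * g1 j) ⊗ₜ[k] l) * σ (h2 i ⊗ₜ[k] g2 j))
    (hσ1 : ∀ h : B, σ (h ⊗ₜ[k] (1 : B)) = Coalgebra.counit (R := k) h)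
    (hσ1' : ∀ h : B, σ ((1 : B) ⊗ₜ[k] h) = Coalgebra.counit (R := k) h)
    (IB : (B ⊗[k] E) ⊗[k] (B ⊗[k] E) →ₗ[k] k)
    (hIB : ∀ (b : B) (c : E) (b' : B) (c' : E) (n : ℕ) (p1 p2 : Fin n → B),
      Coalgebra.comul (R := k) b' = ∑ i, p1 i ⊗ₜ[k] p2 i →
      IB ((b ⊗ₜ[k] c) ⊗ₜ[k] (b' ⊗ₜ[k] c'))
        = ∑ i, σ (b ⊗ₜ[k] p2 i) * ev c (p1 i) * Coalgebra.counit (R := k) c') :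
    AbsCoc mD IB := by
  have c1 : toConv σ * toConv σinv = 1 := by
    refine ext_tmul _ _ fun x y => ?_
    obtain ⟨n, a, b, h⟩ := exists_rep (comul (R := k) x)
    obtain ⟨m, c, d, h'⟩ := exists_rep (comul (R := k) y)
    rw [conv_tmul _ _ _ _ _ _ _ _ h h', one_tmul_apply]
    exact (hσconv x y _ _ _ _ _ _ h h').1
  have c2 : toConv σinv * toConv σ = 1 := by
    refine ext_tmul _ _ fun x y => ?_
    obtain ⟨n, a, b, h⟩ := exists_rep (comul (R := k) x)
    obtain ⟨m, c, d, h'⟩ := exists_rep (comul (R := k) y)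
    rw [conv_tmul _ _ _ _ _ _ _ _ h h', one_tmul_apply]
    exact (hσconv x y _ _ _ _ _ _ h h').2
  have c3 : RightCoc (toConv σ) := by
    unfold RightCoc
    ext x y z
    obtain ⟨n, a, b, h⟩ := exists_rep (comul (R := k) x)
    obtain ⟨m, c, d, h'⟩ := exists_rep (comul (R := k) y)
    obtain ⟨l, e, f, h''⟩ := exists_rep (comul (R := k) z)
    refine (apply_right23 x y z _ _).trans (Eq.trans ?_ (apply_right12 x y z _ _).symm)
    rw [conv_tmul _ _ _ _ _ _ _ _ h' h'', conv_tmul _ _ _ _ _ _ _ _ h h']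
    exact hσcocycle x y z _ _ _ _ _ _ h' h'' _ _ _ h
  refine final_aux ev hev1 hev2 hev3 hev4 mD hmD (pull (πBB k B E) (toConv σ))
    (pull (πBB k B E) (toConv σinv)) (toConv IB) ?_ ?_ (c3.pull (πB k B E)) ?_ ?_ ?_
  · rw [← pull_mul, c1, pull_one]
  · rw [← pull_mul, c2, pull_one]
  · ext b c b' c'
    obtain ⟨n, p1, p2, h⟩ := exists_rep (comul (R := k) b')
    obtain ⟨m, q1, q2, h'⟩ := exists_rep (comul (R := k) c)
    refine (hIB b c b' c' _ _ _ h).trans (Eq.trans ?_ (R_mul_apply _ _ b b' c c' _ _ _ _ h' h).symm)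
    rw [Finset.sum_comm]
    refine Finset.sum_congr rfl fun i _ => ?_
    conv_lhs => rw [← collapse_right c q1 q2 h']
    simp [Finset.sum_mul, Finset.mul_sum, ← TensorProduct.smul_tmul']
    refine Finset.sum_congr rfl fun i _ => ?_
    ring
  · intro x
    simp [hσ1, counit_πB]
  · intro x
    simp [hσ1', counit_πB]

theorem final_E (ev : E →ₗ[k] B →ₗ[k] k)
    (hev1 : ∀ (c c' : E) (b : B) (n : ℕ) (b1 b2 : Fin n → B),
      comul (R := k) b = ∑ i, b1 i ⊗ₜ[k] b2 i →
      ev (c * c') b = ∑ i, ev c (b2 i) * ev c' (b1 i))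
    (hev2 : ∀ (c : E) (b b' : B) (m : ℕ) (c1 c2 : Fin m → E),
      comul (R := k) c = ∑ j, c1 j ⊗ₜ[k] c2 j →
      ev c (b * b') = ∑ j, ev (c1 j) b * ev (c2 j) b')
    (hev3 : ∀ b : B, ev 1 b = counit (R := k) b)
    (hev4 : ∀ c : E, ev c 1 = counit (R := k) c)
    (mD : (B ⊗[k] E) ⊗[k] (B ⊗[k] E) →ₗ[k] B ⊗[k] E)
    (hmD : ∀ (b : B) (c : E) (b' : B) (c' : E)
      (n : ℕ) (p1 p2 : Fin n → B) (q : Fin n → ℕ) (pp1 pp2 : (i : Fin n) → Fin (q i) → B)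
      (m : ℕ) (r1 r2 : Fin m → E) (s : Fin m → ℕ) (rr1 rr2 : (j : Fin m) → Fin (s j) → E),
      comul (R := k) b' = ∑ i, p1 i ⊗ₜ[k] p2 i →
      (∀ i, comul (R := k) (p2 i) = ∑ i', pp1 i i' ⊗ₜ[k] pp2 i i') →
      comul (R := k) c = ∑ j, r2 j ⊗ₜ[k] r1 j →
      (∀ j, comul (R := k) (r2 j) = ∑ j', rr2 j j' ⊗ₜ[k] rr1 j j') →
      mD ((b ⊗ₜ[k] c) ⊗ₜ[k] (b' ⊗ₜ[k] c'))
        = ∑ i, ∑ i', ∑ j, ∑ j',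
            (ev (r1 j) (HopfAlgebra.antipode k (pp2 i i')) * ev (rr2 j j') (p1 i))
              • ((b * pp1 i i') ⊗ₜ[k] (rr1 j j' * c')))
    (τ τinv : E ⊗[k] E →ₗ[k] k)
    (c1 : toConv τ * toConv τinv = 1) (c2 : toConv τinv * toConv τ = 1)
    (c3 : RightCoc (toConv τ))
    (hτ1 : ∀ h : E, τ (h ⊗ₜ[k] (1 : E)) = Coalgebra.counit (R := k) h)
    (hτ1' : ∀ h : E, τ ((1 : E) ⊗ₜ[k] h) = Coalgebra.counit (R := k) h)
    (IC : (B ⊗[k] E) ⊗[k] (B ⊗[k] E) →ₗ[k] k)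
    (hIC : ∀ (b : B) (c : E) (b' : B) (c' : E) (m : ℕ) (r1 r2 : Fin m → E),
      Coalgebra.comul (R := k) c = ∑ j, r2 j ⊗ₜ[k] r1 j →
      IC ((b ⊗ₜ[k] c) ⊗ₜ[k] (b' ⊗ₜ[k] c'))
        = Coalgebra.counit (R := k) b * ∑ j, τ (r1 j ⊗ₜ[k] c') * ev (r2 j) b') :
    AbsCoc mD IC := by
  refine final_aux ev hev1 hev2 hev3 hev4 mD hmD (pull (πEE k B E) (toConv τ))
    (pull (πEE k B E) (toConv τinv)) (toConv IC) ?_ ?_ (c3.pull (πE k B E)) ?_ ?_ ?_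
  · rw [← pull_mul, c1, pull_one]
  · rw [← pull_mul, c2, pull_one]
  · ext b c b' c'
    obtain ⟨n, p1, p2, h⟩ := exists_rep (comul (R := k) b')
    obtain ⟨m, q1, q2, h'⟩ := exists_rep (comul (R := k) c)
    refine (hIC b c b' c' _ _ _ h').trans (Eq.trans ?_ (R_mul_apply _ _ b b' c c' _ _ _ _ h' h).symm)
    rw [Finset.mul_sum]
    refine Finset.sum_congr rfl fun i _ => ?_
    conv_lhs => rw [← collapse_right b' p1 p2 h]
    simp [Finset.sum_mul, Finset.mul_sum, ← TensorProduct.smul_tmul']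
    refine Finset.sum_congr rfl fun i _ => ?_
    ring
  · intro x
    simp [hτ1, counit_πE]
  · intro x
    simp [hτ1', counit_πE]
end final
end double

section cop
variable {k C : Type} [Field k] [Ring C] [Bialgebra k C]

/-- the co-opposite bialgebra -/
def Cop (C : Type) : Type := C
instance : Ring (Cop C) := inferInstanceAs (Ring C)
instance : Algebra k (Cop C) := inferInstanceAs (Algebra k C)

def copComul (k C : Type) [Field k] [Ring C] [Bialgebra k C] : C →ₗ[k] C ⊗[k] C :=
  (TensorProduct.comm k C C).toLinearMap ∘ₗ comul (R := k)

lemma copComul_rep (x : C) {n : ℕ} (a b : Fin n → C)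
    (h : comul (R := k) x = ∑ i, a i ⊗ₜ[k] b i) : copComul k C x = ∑ i, b i ⊗ₜ[k] a i := by
  simp [copComul, h]

lemma copComul_rep' (x : C) {n : ℕ} (a b : Fin n → C)
    (h : copComul k C x = ∑ i, a i ⊗ₜ[k] b i) : comul (R := k) x = ∑ i, b i ⊗ₜ[k] a i := by
  have := congrArg (TensorProduct.comm k C C) h
  simpa [copComul] using this

lemma cop_coassoc : (TensorProduct.assoc k C C C).toLinearMap ∘ₗ (copComul k C).rTensor C ∘ₗ copComul k C =
    (copComul k C).lTensor C ∘ₗ copComul k C := by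
  ext x
  choose N u v huv using fun x : C => exists_rep (comul (R := k) x)
  have h := coassoc_symm_apply (R := k) x
  rw [huv x] at h
  simp only [map_sum, LinearMap.lTensor_tmul, LinearMap.rTensor_tmul, huv (u x _), huv (v x _),
    TensorProduct.tmul_sum, TensorProduct.sum_tmul, TensorProduct.assoc_symm_tmul] at h
  have h2 := congrArg ((TensorProduct.assoc k C C C).toLinearMap ∘ₗ TensorProduct.map
    (TensorProduct.comm k C C).toLinearMap LinearMap.id ∘ₗ
    (TensorProduct.comm k C (C ⊗[k] C)).toLinearMap ∘ₗ
    (TensorProduct.assoc k C C C).toLinearMap) h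
  simp at h2
  simp [copComul_rep _ _ _ (huv _), map_sum, TensorProduct.tmul_sum, TensorProduct.sum_tmul]
  exact h2

instance : Coalgebra k (Cop C) where
  comul := copComul k C
  counit := counit (R := k) (A := C)
  coassoc := cop_coassoc (k := k) (C := C)
  rTensor_counit_comp_comul := by
    refine LinearMap.ext fun (x : C) => ?_
    obtain ⟨n, a, b, h⟩ := exists_rep (comul (R := k) x)
    change (counit (R := k) (A := C)).rTensor C (copComul k C x) = (1 : k) ⊗ₜ[k] x
    rw [copComul_rep x a b h]
    conv_rhs => rw [← collapse_right x a b h]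
    simp [TensorProduct.tmul_sum, TensorProduct.tmul_smul, TensorProduct.smul_tmul']
  lTensor_counit_comp_comul := by
    refine LinearMap.ext fun (x : C) => ?_
    obtain ⟨n, a, b, h⟩ := exists_rep (comul (R := k) x)
    change (counit (R := k) (A := C)).lTensor C (copComul k C x) = x ⊗ₜ[k] (1 : k)
    rw [copComul_rep x a b h]
    conv_rhs => rw [← collapse_left x a b h]
    simp [TensorProduct.sum_tmul, TensorProduct.smul_tmul]

lemma copComul_mul (x y : C) : copComul k C (x * y) = copComul k C x * copComul k C y := by
  simp only [copComul, LinearMap.comp_apply, Bialgebra.comul_mul]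
  exact map_mul (Algebra.TensorProduct.comm k C C) _ _

lemma copComul_one : copComul k C 1 = 1 := by
  simp [copComul, Algebra.TensorProduct.one_def]

instance : Bialgebra k (Cop C) := Bialgebra.mk' k (Cop C)
  (Bialgebra.counit_one (R := k) (A := C)) (fun {a b} => Bialgebra.counit_mul (R := k) (A := C) a b)
  (copComul_one (k := k) (C := C)) (fun {x y} => copComul_mul (k := k) (C := C) x y)

lemma cop_rep (x : C) {n : ℕ} (a b : Fin n → C)
    (h : comul (R := k) x = ∑ i, a i ⊗ₜ[k] b i) :
    comul (R := k) (A := Cop C) x = ∑ i, (b i : Cop C) ⊗ₜ[k] (a i : Cop C) :=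
  copComul_rep x a b h

lemma cop_rep' (x : C) {n : ℕ} (a b : Fin n → C)
    (h : comul (R := k) (A := Cop C) x = ∑ i, (a i : Cop C) ⊗ₜ[k] (b i : Cop C)) :
    comul (R := k) x = ∑ i, b i ⊗ₜ[k] a i :=
  copComul_rep' x a b h

end cop
end DrinAux

namespace DrinAux
open Coalgebra WithConv
section bridge
variable {k B C : Type} [Field k] [Ring B] [HopfAlgebra k B] [Ring C] [HopfAlgebra k C]

lemma drinCounit_eq (x : B ⊗[k] C) :
    DrinCounit k B C x = counit (R := k) (A := B ⊗[k] Cop C) x := by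
  suffices h : DrinCounit k B C = counit (R := k) (A := B ⊗[k] Cop C) from
    congrArg (fun f : B ⊗[k] C →ₗ[k] k => f x) h
  refine TensorProduct.ext' fun b c => ?_
  refine Eq.trans ?_ (TensorProduct.counit_tmul (R := k) (S := k) (A := B) (B := Cop C) b c).symm
  simp only [DrinCounit, LinearMap.comp_apply, TensorProduct.map_tmul, LinearMap.mul'_apply,
    smul_eq_mul]
  exact mul_comm _ _

lemma drin_of_abs (mD : (B ⊗[k] C) ⊗[k] (B ⊗[k] C) →ₗ[k] B ⊗[k] C)
    (γ : (B ⊗[k] C) ⊗[k] (B ⊗[k] C) →ₗ[k] k)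
    (h : AbsCoc (k := k) (D := B ⊗[k] Cop C) mD γ) : IsRightTwoCocycleOnDrin mD γ := by
  obtain ⟨⟨γinv, h1⟩, h2, h3, h4⟩ := h
  refine ⟨⟨γinv, fun x y n m x1 x2 y1 y2 hx hy => ?_⟩,
    fun x y z n m p x1 x2 y1 y2 z1 z2 hx hy hz => ?_, fun x => ?_, fun x => ?_⟩
  · rw [drinCounit_eq, drinCounit_eq]
    exact h1 x y n m x1 x2 y1 y2 hx hy
  · exact h2 x y z n m p x1 x2 y1 y2 z1 z2 hx hy hz
  · rw [drinCounit_eq]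
    exact h3 x
  · rw [drinCounit_eq]
    exact h4 x
end bridge
end DrinAux

theorem induced_two_cocycles_on_drinfeld_double
    (ev : C →ₗ[k] B →ₗ[k] k) (hev : IsWeakHopfPairing ev)
    (mD : (B ⊗[k] C) ⊗[k] (B ⊗[k] C) →ₗ[k] B ⊗[k] C) (hmD : IsDrinMul ev mD)
    -- `σ` is a right 2-cocycle on `B`
    (σ σinv : B ⊗[k] B →ₗ[k] k)
    (hσconv : ∀ (a b : B) (n m : ℕ) (a1 a2 : Fin n → B) (b1 b2 : Fin m → B),
      Coalgebra.comul (R := k) a = ∑ i, a1 i ⊗ₜ[k] a2 i →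
      Coalgebra.comul (R := k) b = ∑ j, b1 j ⊗ₜ[k] b2 j →
      (∑ i, ∑ j, σ (a1 i ⊗ₜ[k] b1 j) * σinv (a2 i ⊗ₜ[k] b2 j)
          = Coalgebra.counit (R := k) a * Coalgebra.counit (R := k) b) ∧
      (∑ i, ∑ j, σinv (a1 i ⊗ₜ[k] b1 j) * σ (a2 i ⊗ₜ[k] b2 j)
          = Coalgebra.counit (R := k) a * Coalgebra.counit (R := k) b))
    (hσcocycle : ∀ (h g l : B) (m p : ℕ) (g1 g2 : Fin m → B) (l1 l2 : Fin p → B),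
      Coalgebra.comul (R := k) g = ∑ j, g1 j ⊗ₜ[k] g2 j →
      Coalgebra.comul (R := k) l = ∑ s, l1 s ⊗ₜ[k] l2 s →
      ∀ (n : ℕ) (h1 h2 : Fin n → B),
      Coalgebra.comul (R := k) h = ∑ i, h1 i ⊗ₜ[k] h2 i →
      ∑ j, ∑ s, σ (h ⊗ₜ[k] (g1 j * l1 s)) * σ (g2 j ⊗ₜ[k] l2 s)
        = ∑ i, ∑ j, σ ((h1 i * g1 j) ⊗ₜ[k] l) * σ (h2 i ⊗ₜ[k] g2 j))
    (hσ1 : ∀ h : B, σ (h ⊗ₜ[k] (1 : B)) = Coalgebra.counit (R := k) h)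
    (hσ1' : ∀ h : B, σ ((1 : B) ⊗ₜ[k] h) = Coalgebra.counit (R := k) h)
    -- `τ` is a left 2-cocycle on `C`
    (τ τinv : C ⊗[k] C →ₗ[k] k)
    (hτconv : ∀ (a b : C) (n m : ℕ) (a1 a2 : Fin n → C) (b1 b2 : Fin m → C),
      Coalgebra.comul (R := k) a = ∑ i, a1 i ⊗ₜ[k] a2 i →
      Coalgebra.comul (R := k) b = ∑ j, b1 j ⊗ₜ[k] b2 j →
      (∑ i, ∑ j, τ (a1 i ⊗ₜ[k] b1 j) * τinv (a2 i ⊗ₜ[k] b2 j)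
          = Coalgebra.counit (R := k) a * Coalgebra.counit (R := k) b) ∧
      (∑ i, ∑ j, τinv (a1 i ⊗ₜ[k] b1 j) * τ (a2 i ⊗ₜ[k] b2 j)
          = Coalgebra.counit (R := k) a * Coalgebra.counit (R := k) b))
    (hτcocycle : ∀ (h g l : C) (m p : ℕ) (g1 g2 : Fin m → C) (l1 l2 : Fin p → C),
      Coalgebra.comul (R := k) g = ∑ j, g1 j ⊗ₜ[k] g2 j →
      Coalgebra.comul (R := k) l = ∑ s, l1 s ⊗ₜ[k] l2 s →
      ∀ (n : ℕ) (h1 h2 : Fin n → C),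
      Coalgebra.comul (R := k) h = ∑ i, h1 i ⊗ₜ[k] h2 i →
      ∑ j, ∑ s, τ (h ⊗ₜ[k] (g2 j * l2 s)) * τ (g1 j ⊗ₜ[k] l1 s)
        = ∑ i, ∑ j, τ ((h2 i * g2 j) ⊗ₜ[k] l) * τ (h1 i ⊗ₜ[k] g1 j))
    (hτ1 : ∀ c : C, τ (c ⊗ₜ[k] (1 : C)) = Coalgebra.counit (R := k) c)
    (hτ1' : ∀ c : C, τ ((1 : C) ⊗ₜ[k] c) = Coalgebra.counit (R := k) c)
    -- `IB = Ind_B σ` and `IC = Ind_C τ`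
    (IB : (B ⊗[k] C) ⊗[k] (B ⊗[k] C) →ₗ[k] k)
    (hIB : ∀ (b : B) (c : C) (b' : B) (c' : C) (n : ℕ) (p1 p2 : Fin n → B),
      Coalgebra.comul (R := k) b' = ∑ i, p1 i ⊗ₜ[k] p2 i →
      IB ((b ⊗ₜ[k] c) ⊗ₜ[k] (b' ⊗ₜ[k] c'))
        = ∑ i, σ (b ⊗ₜ[k] p2 i) * ev c (p1 i) * Coalgebra.counit (R := k) c')
    (IC : (B ⊗[k] C) ⊗[k] (B ⊗[k] C) →ₗ[k] k)
    (hIC : ∀ (b : B) (c : C) (b' : B) (c' : C) (m : ℕ) (r1 r2 : Fin m → C),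
      Coalgebra.comul (R := k) c = ∑ j, r1 j ⊗ₜ[k] r2 j →
      IC ((b ⊗ₜ[k] c) ⊗ₜ[k] (b' ⊗ₜ[k] c'))
        = Coalgebra.counit (R := k) b * ∑ j, τ (r1 j ⊗ₜ[k] c') * ev (r2 j) b') :
    IsRightTwoCocycleOnDrin mD IB ∧ IsRightTwoCocycleOnDrin mD IC := by
  obtain ⟨hev1, hev2, hev3, hev4, -⟩ := hev
  have hev2' : ∀ (c : DrinAux.Cop C) (b b' : B) (m : ℕ) (c1 c2 : Fin m → DrinAux.Cop C),
      Coalgebra.comul (R := k) c = ∑ j, c1 j ⊗ₜ[k] c2 j →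
      ev c (b * b') = ∑ j, ev (c1 j) b * ev (c2 j) b' := by
    intro c b b' m c1 c2 h
    refine (hev2 c b b' m c2 c1 (DrinAux.cop_rep' (k := k) (C := C) c c1 c2 h)).trans ?_
    exact Finset.sum_congr rfl fun i _ => mul_comm _ _
  have hmD' := fun (b : B) (c : DrinAux.Cop C) (b' : B) (c' : DrinAux.Cop C)
      (n : ℕ) (p1 p2 : Fin n → B) (q : Fin n → ℕ) (pp1 pp2 : (i : Fin n) → Fin (q i) → B)
      (m : ℕ) (r1 r2 : Fin m → DrinAux.Cop C) (s : Fin m → ℕ)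
      (rr1 rr2 : (j : Fin m) → Fin (s j) → DrinAux.Cop C)
      (h1 : Coalgebra.comul (R := k) b' = ∑ i, p1 i ⊗ₜ[k] p2 i)
      (h2 : ∀ i, Coalgebra.comul (R := k) (p2 i) = ∑ i', pp1 i i' ⊗ₜ[k] pp2 i i')
      (h3 : Coalgebra.comul (R := k) c = ∑ j, r2 j ⊗ₜ[k] r1 j)
      (h4 : ∀ j, Coalgebra.comul (R := k) (r2 j) = ∑ j', rr2 j j' ⊗ₜ[k] rr1 j j') =>
    hmD b c b' c' n p1 p2 q pp1 pp2 m r1 r2 s rr1 rr2 h1 h2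
      (DrinAux.cop_rep' (k := k) (C := C) c r2 r1 h3)
      (fun j => DrinAux.cop_rep' (k := k) (C := C) (r2 j) (rr2 j) (rr1 j) (h4 j))
  constructor
  · exact DrinAux.drin_of_abs mD IB (DrinAux.final_B (E := DrinAux.Cop C) ev hev1 hev2' hev3 hev4
      mD hmD' σ σinv hσconv hσcocycle hσ1 hσ1' IB hIB)
  · have c1 : WithConv.toConv (A := DrinAux.Cop C ⊗[k] DrinAux.Cop C →ₗ[k] k) τ *
        WithConv.toConv (A := DrinAux.Cop C ⊗[k] DrinAux.Cop C →ₗ[k] k) τinv = 1 := by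
      refine DrinAux.ext_tmul _ _ fun x y => ?_
      obtain ⟨n, a, b, h⟩ := DrinAux.exists_rep (Coalgebra.comul (R := k) (A := C) x)
      obtain ⟨m, c, d, h'⟩ := DrinAux.exists_rep (Coalgebra.comul (R := k) (A := C) y)
      refine (DrinAux.conv_tmul _ _ _ _ _ _ _ _ (DrinAux.cop_rep (k := k) (C := C) x a b h)
        (DrinAux.cop_rep (k := k) (C := C) y c d h')).trans ?_
      rw [DrinAux.one_tmul_apply]
      refine Eq.trans ?_ (hτconv x y _ _ _ _ _ _ h h').2
      exact Finset.sum_congr rfl fun i _ => Finset.sum_congr rfl fun j _ => mul_comm _ _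
    have c2 : WithConv.toConv (A := DrinAux.Cop C ⊗[k] DrinAux.Cop C →ₗ[k] k) τinv *
        WithConv.toConv (A := DrinAux.Cop C ⊗[k] DrinAux.Cop C →ₗ[k] k) τ = 1 := by
      refine DrinAux.ext_tmul _ _ fun x y => ?_
      obtain ⟨n, a, b, h⟩ := DrinAux.exists_rep (Coalgebra.comul (R := k) (A := C) x)
      obtain ⟨m, c, d, h'⟩ := DrinAux.exists_rep (Coalgebra.comul (R := k) (A := C) y)
      refine (DrinAux.conv_tmul _ _ _ _ _ _ _ _ (DrinAux.cop_rep (k := k) (C := C) x a b h)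
        (DrinAux.cop_rep (k := k) (C := C) y c d h')).trans ?_
      rw [DrinAux.one_tmul_apply]
      refine Eq.trans ?_ (hτconv x y _ _ _ _ _ _ h h').1
      exact Finset.sum_congr rfl fun i _ => Finset.sum_congr rfl fun j _ => mul_comm _ _
    have c3 : DrinAux.RightCoc (k := k) (D := DrinAux.Cop C)
        (WithConv.toConv (A := DrinAux.Cop C ⊗[k] DrinAux.Cop C →ₗ[k] k) τ) := by
      unfold DrinAux.RightCoc
      ext x y z
      obtain ⟨n, a, b, h⟩ := DrinAux.exists_rep (Coalgebra.comul (R := k) (A := C) x)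
      obtain ⟨m, c, d, h'⟩ := DrinAux.exists_rep (Coalgebra.comul (R := k) (A := C) y)
      obtain ⟨l, e, f, h''⟩ := DrinAux.exists_rep (Coalgebra.comul (R := k) (A := C) z)
      refine (DrinAux.apply_right23 x y z _ _).trans
        (Eq.trans ?_ (DrinAux.apply_right12 x y z _ _).symm)
      refine (DrinAux.conv_tmul _ _ _ _ _ _ _ _ (DrinAux.cop_rep (k := k) (C := C) y c d h')
        (DrinAux.cop_rep (k := k) (C := C) z e f h'')).trans (Eq.trans ?_
        (DrinAux.conv_tmul _ _ _ _ _ _ _ _ (DrinAux.cop_rep (k := k) (C := C) x a b h)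
        (DrinAux.cop_rep (k := k) (C := C) y c d h')).symm)
      exact hτcocycle x y z _ _ _ _ _ _ h' h'' _ _ _ h
    exact DrinAux.drin_of_abs mD IC (DrinAux.final_E (E := DrinAux.Cop C) ev hev1 hev2' hev3 hev4
      mD hmD' τ τinv c1 c2 c3 hτ1 hτ1' IC
      (fun b c b' c' m r1 r2 h => hIC b c b' c' m r1 r2
        (DrinAux.cop_rep' (k := k) (C := C) c r2 r1 h)))

end
end
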